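/- Let p ∈ Λ₂ be a plaquette and m ≥ 1. The number of knots K ∈ 𝒦 with |K| = m and p ∈ K is at most (10²⁴)^m. -/

import Mathlib

open Classical SimpleGraph
open scoped BigOperators

noncomputable section

namespace LGT

/-- A site of `ℤ⁴`. -/
abbrev Site : Type := Fin 4 → ℤ

/-- The `i`-th coordinate unit vector. -/
def unit (i : Fin 4) : Site := fun j => if j = i then 1 else 0

lemma unit_apply_self (i : Fin 4) : unit i i = 1 := by simp [unit]

lemma unit_apply_nonneg (i j : Fin 4) : 0 ≤ unit i j := by
  by_cases h : j = i <;> simp [unit, h]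

lemma unit_ne_zero (i : Fin 4) : unit i ≠ 0 := by
  intro h
  have h1 := congrFun h i
  rw [unit_apply_self] at h1
  exact one_ne_zero h1

/-- The lattice `Λ = ([a₁,b₁] × ⋯ × [a₄,b₄]) ∩ ℤ⁴`, with all side lengths equal. -/
structure Box where
  a : Fin 4 → ℤ
  b : Fin 4 → ℤ
  side_eq : ∀ i j : Fin 4, b i - a i = b j - a j

/-- Membership of a site in the lattice `Λ`. -/
def Box.mem (Λ : Box) (x : Site) : Prop := ∀ i, Λ.a i ≤ x i ∧ x i ≤ Λ.b i

/-- The set of vertices `Λ₀` of the lattice. -/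
abbrev VSite (Λ : Box) : Type := {x : Site // Λ.mem x}

lemma not_both {x y : Site} {i j : Fin 4} (h1 : y = x + unit i) (h2 : x = y + unit j) :
    False := by
  subst h1
  rw [add_assoc] at h2
  have h3 : unit i + unit j = 0 := left_eq_add.mp h2
  have h4 := congrFun h3 i
  rw [Pi.add_apply, Pi.zero_apply, unit_apply_self] at h4
  have h5 : (0:ℤ) ≤ unit j i := unit_apply_nonneg j i
  omega

/-- The 1-skeleton `S₁(Λ)` of the lattice, as a graph on the vertices of `Λ`:
two vertices are adjacent iff they differ by a coordinate unit vector. -/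
def latticeGraph (Λ : Box) : SimpleGraph (VSite Λ) where
  Adj u v := ∃ i : Fin 4, (v : Site) = (u : Site) + unit i ∨ (u : Site) = (v : Site) + unit i
  symm := by
    constructor
    rintro u v ⟨i, h | h⟩
    · exact ⟨i, Or.inr h⟩
    · exact ⟨i, Or.inl h⟩
  loopless := by
    constructor
    rintro u ⟨i, h | h⟩ <;> exact unit_ne_zero i (left_eq_add.mp h)

/-- The set `Λ₁` of positively oriented nearest-neighbour edges of `Λ`:
an edge is a pair (base site, direction) whose endpoints both lie in `Λ`. -/
abbrev PEdge (Λ : Box) : Type :=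
  {e : Site × Fin 4 // Λ.mem e.1 ∧ Λ.mem (e.1 + unit e.2)}

/-- The initial vertex of a positively oriented edge. -/
def PEdge.v0 {Λ : Box} (e : PEdge Λ) : VSite Λ := ⟨e.1.1, e.2.1⟩

/-- The final vertex of a positively oriented edge. -/
def PEdge.v1 {Λ : Box} (e : PEdge Λ) : VSite Λ := ⟨e.1.1 + unit e.1.2, e.2.2⟩

/-- Edge configurations `σ ∈ G^{Λ₁}`. -/
abbrev EdgeConf (Λ : Box) (G : Type*) : Type _ := PEdge Λ → G

variable {G : Type*} [Group G]

/-- The value of an edge configuration on an oriented edge `(u, v)`: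
`σ_e` on positively oriented edges, `σ_e⁻¹` on negatively oriented ones. -/
def oval {Λ : Box} (σ : EdgeConf Λ G) (u v : VSite Λ) : G :=
  if h : ∃ i : Fin 4, (v : Site) = (u : Site) + unit i then
    σ ⟨((u : Site), h.choose), u.2, by rw [← h.choose_spec]; exact v.2⟩
  else if h' : ∃ i : Fin 4, (u : Site) = (v : Site) + unit i then
    (σ ⟨((v : Site), h'.choose), v.2, by rw [← h'.choose_spec]; exact u.2⟩)⁻¹
  else 1

/-- The holonomy `σ_γ = σ_{e₁} ⋯ σ_{eₙ}` of an edge configuration along a walk. -/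
def hol {Λ : Box} (σ : EdgeConf Λ G) {u v : VSite Λ}
    (w : (latticeGraph Λ).Walk u v) : G :=
  (w.darts.map fun d => oval σ d.toProd.1 d.toProd.2).prod

@[simp] lemma hol_nil {Λ : Box} (σ : EdgeConf Λ G) {u : VSite Λ} :
    hol σ (SimpleGraph.Walk.nil : (latticeGraph Λ).Walk u u) = 1 := by simp [hol]

lemma hol_cons {Λ : Box} (σ : EdgeConf Λ G) {u m v : VSite Λ}
    (h : (latticeGraph Λ).Adj u m) (q : (latticeGraph Λ).Walk m v) :
    hol σ (SimpleGraph.Walk.cons h q) = oval σ u m * hol σ q := by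
  simp [hol]

lemma hol_append {Λ : Box} (σ : EdgeConf Λ G) {u v w : VSite Λ}
    (p : (latticeGraph Λ).Walk u v) (q : (latticeGraph Λ).Walk v w) :
    hol σ (p.append q) = hol σ p * hol σ q := by
  simp [hol, SimpleGraph.Walk.darts_append]

lemma oval_mul_oval {Λ : Box} (σ : EdgeConf Λ G) {u v : VSite Λ}
    (h : (latticeGraph Λ).Adj u v) : oval σ u v * oval σ v u = 1 := by
  obtain ⟨i, hi | hi⟩ := h
  · have h1 : ∃ k : Fin 4, (v : Site) = (u : Site) + unit k := ⟨i, hi⟩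
    have h2 : ¬ ∃ k : Fin 4, (u : Site) = (v : Site) + unit k := by
      rintro ⟨k, hk⟩; exact not_both hi hk
    simp only [oval]
    rw [dif_pos h1, dif_neg h2, dif_pos h1]
    exact mul_inv_cancel _
  · have h1 : ∃ k : Fin 4, (u : Site) = (v : Site) + unit k := ⟨i, hi⟩
    have h2 : ¬ ∃ k : Fin 4, (v : Site) = (u : Site) + unit k := by
      rintro ⟨k, hk⟩; exact not_both hk hi
    simp only [oval]
    rw [dif_neg h2, dif_pos h1, dif_pos h1]
    exact inv_mul_cancel _

/-- One step of combinatorial homotopy of walks in the 1-skeleton: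
inserting or removing a backtracking `e e⁻¹`. -/
inductive HStep {Λ : Box} :
    {u v : VSite Λ} → (latticeGraph Λ).Walk u v → (latticeGraph Λ).Walk u v → Prop
  | mk {u x y v : VSite Λ} (p : (latticeGraph Λ).Walk u x) (h : (latticeGraph Λ).Adj x y)
      (q : (latticeGraph Λ).Walk x v) :
      HStep (p.append (SimpleGraph.Walk.cons h (SimpleGraph.Walk.cons h.symm q)))
        (p.append q)

/-- Two walks in the 1-skeleton are homotopic if they differ by finitely many
insertions/removals of backtrackings.  The equivalence classes of closed walks based
at `x₀` are exactly the elements of the fundamental group `π₁(S₁(Λ), x₀)`. -/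
def Homotopic {Λ : Box} {u v : VSite Λ}
    (w₁ w₂ : (latticeGraph Λ).Walk u v) : Prop :=
  Relation.EqvGen (@HStep Λ u v) w₁ w₂

lemma hol_of_hstep {Λ : Box} (σ : EdgeConf Λ G) {u v : VSite Λ}
    {w₁ w₂ : (latticeGraph Λ).Walk u v} (h : HStep w₁ w₂) : hol σ w₁ = hol σ w₂ := by
  cases h with
  | mk p had q =>
    simp only [hol_append, hol_cons, ← mul_assoc]
    rw [mul_assoc (hol σ p), oval_mul_oval σ had, mul_one]

lemma hol_homotopic {Λ : Box} (σ : EdgeConf Λ G) {u v : VSite Λ}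
    {w₁ w₂ : (latticeGraph Λ).Walk u v} (h : Homotopic w₁ w₂) : hol σ w₁ = hol σ w₂ := by
  induction h with
  | rel _ _ hs => exact hol_of_hstep σ hs
  | refl _ => rfl
  | symm _ _ _ ih => exact ih.symm
  | trans _ _ _ _ _ ih₁ ih₂ => exact ih₁.trans ih₂

/-- The set `Ω = Hom(π₁(S₁(Λ), x₀), G)` of homomorphisms from the fundamental group
of the 1-skeleton based at `x₀` to `G`, modelled as functions on closed walks at `x₀`
that are homotopy invariant and multiplicative under concatenation. -/
structure Hom (Λ : Box) (x₀ : VSite Λ) (G : Type*) [Group G] where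
  toFun : (latticeGraph Λ).Walk x₀ x₀ → G
  invariant : ∀ w₁ w₂ : (latticeGraph Λ).Walk x₀ x₀, Homotopic w₁ w₂ → toFun w₁ = toFun w₂
  map_mul : ∀ w₁ w₂ : (latticeGraph Λ).Walk x₀ x₀, toFun (w₁.append w₂) = toFun w₁ * toFun w₂

/-- The map `ψ_{x₀} : G^{Λ₁} → Ω` sending an edge configuration to the induced
homomorphism of the fundamental group, given by holonomy along loops. -/
def psi (Λ : Box) (x₀ : VSite Λ) (σ : EdgeConf Λ G) : Hom Λ x₀ G where
  toFun := hol σ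
  invariant := fun _ _ h => hol_homotopic σ h
  map_mul := fun w₁ w₂ => hol_append σ w₁ w₂


/-- The set `Λ₂` of plaquettes of `Λ`: unit squares, given by a base site and two
distinct directions, all four of whose corners (hence all four boundary edges) lie in `Λ`. -/
abbrev Plaq (Λ : Box) : Type :=
  {q : Site × Fin 4 × Fin 4 //
    q.2.1 < q.2.2 ∧ Λ.mem q.1 ∧ Λ.mem (q.1 + unit q.2.1) ∧
    Λ.mem (q.1 + unit q.2.1 + unit q.2.2) ∧ Λ.mem (q.1 + unit q.2.2)}

namespace Plaq

variable {Λ : Box}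

/-- First corner `x₁` of a plaquette. -/
def c0 (p : Plaq Λ) : VSite Λ := ⟨p.1.1, p.2.2.1⟩
/-- Second corner `x₂` of a plaquette. -/
def c1 (p : Plaq Λ) : VSite Λ := ⟨p.1.1 + unit p.1.2.1, p.2.2.2.1⟩
/-- Third corner `x₃` of a plaquette. -/
def c2 (p : Plaq Λ) : VSite Λ := ⟨p.1.1 + unit p.1.2.1 + unit p.1.2.2, p.2.2.2.2.1⟩
/-- Fourth corner `x₄` of a plaquette. -/
def c3 (p : Plaq Λ) : VSite Λ := ⟨p.1.1 + unit p.1.2.2, p.2.2.2.2.2⟩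

/-- A site is a corner (vertex) of the plaquette. -/
def isCorner (p : Plaq Λ) (x : Site) : Prop :=
  x = (p.c0 : Site) ∨ x = (p.c1 : Site) ∨ x = (p.c2 : Site) ∨ x = (p.c3 : Site)

lemma adj01 (p : Plaq Λ) : (latticeGraph Λ).Adj p.c0 p.c1 := ⟨p.1.2.1, Or.inl rfl⟩
lemma adj12 (p : Plaq Λ) : (latticeGraph Λ).Adj p.c1 p.c2 := ⟨p.1.2.2, Or.inl rfl⟩
lemma adj23 (p : Plaq Λ) : (latticeGraph Λ).Adj p.c2 p.c3 :=
  ⟨p.1.2.1, Or.inr (add_right_comm p.1.1 (unit p.1.2.1) (unit p.1.2.2))⟩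
lemma adj30 (p : Plaq Λ) : (latticeGraph Λ).Adj p.c3 p.c0 := ⟨p.1.2.2, Or.inr rfl⟩

end Plaq

/-- The counter-clockwise boundary loop `γ_p : x₁ → x₂ → x₃ → x₄ → x₁` of a plaquette. -/
def plaqWalk {Λ : Box} (p : Plaq Λ) : (latticeGraph Λ).Walk p.c0 p.c0 :=
  SimpleGraph.Walk.cons p.adj01 (SimpleGraph.Walk.cons p.adj12
    (SimpleGraph.Walk.cons p.adj23 (SimpleGraph.Walk.cons p.adj30 SimpleGraph.Walk.nil)))

variable {G : Type*} [Group G]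

/-- The plaquette variable `σ_p`: the holonomy of `σ` around the boundary of `p`. -/
def holP {Λ : Box} (σ : EdgeConf Λ G) (p : Plaq Λ) : G := hol σ (plaqWalk p)

/-- The support of an edge configuration: the plaquettes `p` with `σ_p ≠ 1`. -/
def esupp {Λ : Box} (σ : EdgeConf Λ G) : Set (Plaq Λ) := {p | holP σ p ≠ 1}

/-- The character `χ = Tr ρ` of a unitary representation `ρ` of `G` of dimension `d`. -/
def chi {G : Type*} [Group G] {d : ℕ} (ρ : G →* Matrix.unitaryGroup (Fin d) ℂ) (g : G) : ℂ :=
  Matrix.trace ((ρ g : Matrix (Fin d) (Fin d) ℂ))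

/-- `Δ_G := min_{g ≠ 1} Re (χ(1) - χ(g))`. -/
def DeltaG (G : Type*) [Group G] (χ : G → ℂ) : ℝ :=
  sInf ((fun g => (χ 1 - χ g).re) '' {g : G | g ≠ 1})

/-- `φ_β(g) = exp(-β Re(χ(1) - χ(g)))`. -/
def phiB {G : Type*} [Group G] (χ : G → ℂ) (β : ℝ) (g : G) : ℝ :=
  Real.exp (-(β * (χ 1 - χ g).re))

/-- The Wilson action `S_Λ(σ) = Σ_{p ∈ Λ₂} Re (χ(1) - χ(σ_p))`. -/
def action (Λ : Box) (χ : G → ℂ) (σ : EdgeConf Λ G) : ℝ :=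
  ∑ᶠ p : Plaq Λ, (χ 1 - χ (holP σ p)).re

/-- The partition function `Z_{Λ,β}` of the lattice gauge theory. -/
def muZ (Λ : Box) (G : Type*) [Group G] (χ : G → ℂ) (β : ℝ) : ℝ :=
  ∑ᶠ σ : EdgeConf Λ G, Real.exp (-(β * action Λ χ σ))

/-- The probability `μ_{Λ,β}(σ) = Z⁻¹ e^{-β S_Λ(σ)}` of an edge configuration. -/
def muP (Λ : Box) (χ : G → ℂ) (β : ℝ) (σ : EdgeConf Λ G) : ℝ :=
  Real.exp (-(β * action Λ χ σ)) / muZ Λ G χ β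

/-- Expectation `E[f(Σ)]` for `Σ ∼ μ_{Λ,β}`. -/
def muE (Λ : Box) (χ : G → ℂ) (β : ℝ) (f : EdgeConf Λ G → ℂ) : ℂ :=
  ∑ᶠ σ : EdgeConf Λ G, (muP Λ χ β σ : ℂ) * f σ

/-- Covariance `Cov(f(Σ), g(Σ))` for `Σ ∼ μ_{Λ,β}`. -/
def muCov (Λ : Box) (χ : G → ℂ) (β : ℝ) (f g : EdgeConf Λ G → ℂ) : ℂ :=
  muE Λ χ β (fun σ => f σ * g σ) - muE Λ χ β f * muE Λ χ β g

section HomSide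

variable (Λ : Box) (x₀ : VSite Λ)

/-- Given fixed paths `ℓ(x₀,x)` and a closed loop `γ` based at `u`, the loop
`ξ_γ = ℓ(x₀,u) γ ℓ(x₀,u)⁻¹ ∈ π₁(S₁(Λ), x₀)` (as a based closed walk). -/
def xiLoop (ℓb : ∀ x : VSite Λ, (latticeGraph Λ).Walk x₀ x) {u : VSite Λ}
    (γ : (latticeGraph Λ).Walk u u) : (latticeGraph Λ).Walk x₀ x₀ :=
  (ℓb u).append (γ.append (ℓb u).reverse)

variable {Λ x₀}

/-- `ψ(ξ_γ)` for a homomorphism `ψ ∈ Ω` and a closed loop `γ`. -/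
def evalLoop (ψ : Hom Λ x₀ G) (ℓb : ∀ x : VSite Λ, (latticeGraph Λ).Walk x₀ x)
    {u : VSite Λ} (γ : (latticeGraph Λ).Walk u u) : G :=
  ψ.toFun (xiLoop Λ x₀ ℓb γ)

/-- `ψ(ξ_p)` for a plaquette `p`. -/
def evalP (ψ : Hom Λ x₀ G) (ℓb : ∀ x : VSite Λ, (latticeGraph Λ).Walk x₀ x)
    (p : Plaq Λ) : G :=
  evalLoop ψ ℓb (plaqWalk p)

/-- The support `supp(ψ) = {p ∈ Λ₂ : ψ(ξ_p) ≠ 1}` of a homomorphism. -/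
def hsupp (ψ : Hom Λ x₀ G) (ℓb : ∀ x : VSite Λ, (latticeGraph Λ).Walk x₀ x) :
    Set (Plaq Λ) :=
  {p | evalP ψ ℓb p ≠ 1}

variable (Λ x₀)

/-- The (unnormalized) weight `∏_{p ∈ Λ₂} φ_β(ψ(ξ_p))` of a homomorphism. -/
def nuW (χ : G → ℂ) (β : ℝ) (ℓb : ∀ x : VSite Λ, (latticeGraph Λ).Walk x₀ x)
    (ψ : Hom Λ x₀ G) : ℝ :=
  ∏ᶠ p : Plaq Λ, phiB χ β (evalP ψ ℓb p)

/-- The normalizing constant `Z^ν_{Λ,β}`. -/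
def nuZ (G : Type*) [Group G] (χ : G → ℂ) (β : ℝ)
    (ℓb : ∀ x : VSite Λ, (latticeGraph Λ).Walk x₀ x) : ℝ :=
  ∑ᶠ ψ : Hom Λ x₀ G, nuW Λ x₀ χ β ℓb ψ

/-- The probability `ν_{Λ,β}(ψ)` of a homomorphism. -/
def nuP (χ : G → ℂ) (β : ℝ) (ℓb : ∀ x : VSite Λ, (latticeGraph Λ).Walk x₀ x)
    (ψ : Hom Λ x₀ G) : ℝ :=
  nuW Λ x₀ χ β ℓb ψ / nuZ Λ x₀ G χ β ℓb

/-- Expectation `E[h(Ψ)]` for `Ψ ∼ ν_{Λ,β}`. -/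
def nuE (χ : G → ℂ) (β : ℝ) (ℓb : ∀ x : VSite Λ, (latticeGraph Λ).Walk x₀ x)
    (h : Hom Λ x₀ G → ℂ) : ℂ :=
  ∑ᶠ ψ : Hom Λ x₀ G, (nuP Λ x₀ χ β ℓb ψ : ℂ) * h ψ

/-- Covariance `Cov(h₁(Ψ), h₂(Ψ))` for `Ψ ∼ ν_{Λ,β}`. -/
def nuCov (χ : G → ℂ) (β : ℝ) (ℓb : ∀ x : VSite Λ, (latticeGraph Λ).Walk x₀ x)
    (h₁ h₂ : Hom Λ x₀ G → ℂ) : ℂ :=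
  nuE Λ x₀ χ β ℓb (fun ψ => h₁ ψ * h₂ ψ) - nuE Λ x₀ χ β ℓb h₁ * nuE Λ x₀ χ β ℓb h₂

/-- For `Ψ₁, Ψ₂` i.i.d. `∼ ν_{Λ,β}`, the probability `P((Ψ₁,Ψ₂) ∈ S)`. -/
def nuP2 (χ : G → ℂ) (β : ℝ) (ℓb : ∀ x : VSite Λ, (latticeGraph Λ).Walk x₀ x)
    (S : Set (Hom Λ x₀ G × Hom Λ x₀ G)) : ℝ :=
  ∑ᶠ pr ∈ S, nuP Λ x₀ χ β ℓb pr.1 * nuP Λ x₀ χ β ℓb pr.2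

end HomSide

/-- Conjugacy invariance: `f(h₁⁻¹g₁h₁, …, h_k⁻¹g_kh_k) = f(g₁, …, g_k)`. -/
def ConjInvariant {G : Type*} [Group G] {k : ℕ} (f : (Fin k → G) → ℂ) : Prop :=
  ∀ g h : Fin k → G, f (fun i => (h i)⁻¹ * g i * h i) = f g

/-- The sup norm `‖f‖_∞` of a complex-valued function. -/
def supNorm {α : Type*} (f : α → ℂ) : ℝ := ⨆ x, ‖f x‖


/-- A rectangle `B = [x₁,y₁] × ⋯ × [x₄,y₄]` contained in `Λ` (degenerate sides allowed). -/
structure Rect (Λ : Box) where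
  lo : Fin 4 → ℤ
  hi : Fin 4 → ℤ
  lo_le_hi : ∀ i, lo i ≤ hi i
  a_le_lo : ∀ i, Λ.a i ≤ lo i
  hi_le_b : ∀ i, hi i ≤ Λ.b i

namespace Rect

variable {Λ : Box}

/-- A site is a vertex of the rectangle. -/
def memV (B : Rect Λ) (x : Site) : Prop := ∀ i, B.lo i ≤ x i ∧ x i ≤ B.hi i

/-- A plaquette is contained in the rectangle (all four corners are vertices of it). -/
def plaqIn (B : Rect Λ) (p : Plaq Λ) : Prop :=
  B.memV (p.c0 : Site) ∧ B.memV (p.c1 : Site) ∧ B.memV (p.c2 : Site) ∧ B.memV (p.c3 : Site)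

/-- The set of plaquettes contained in the rectangle. -/
def plaqSet (B : Rect Λ) : Set (Plaq Λ) := {p | B.plaqIn p}

/-- `|B|`: the number of plaquettes contained in the rectangle. -/
def plaqCard (B : Rect Λ) : ℕ := Nat.card B.plaqSet

end Rect

/-- A walk is contained in a rectangle if all its vertices are vertices of the rectangle. -/
def WalkInRect {Λ : Box} (B : Rect Λ) {u v : VSite Λ}
    (w : (latticeGraph Λ).Walk u v) : Prop :=
  ∀ x ∈ w.support, B.memV (x : Site)

/-- The four boundary edges of a plaquette (as ordered pairs of vertices). -/
def plaqEdges {Λ : Box} (p : Plaq Λ) : List (VSite Λ × VSite Λ) :=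
  [(p.c0, p.c1), (p.c1, p.c2), (p.c3, p.c2), (p.c0, p.c3)]

/-- `(u,v)` is an (unoriented) edge of the 2-complex generated by the plaquette set `Q`. -/
def edgeInComplex {Λ : Box} (Q : Set (Plaq Λ)) (u v : VSite Λ) : Prop :=
  ∃ p ∈ Q, (u, v) ∈ plaqEdges p ∨ (v, u) ∈ plaqEdges p

/-- `u` is a vertex of the 2-complex generated by the plaquette set `Q`. -/
def vertexInComplex {Λ : Box} (Q : Set (Plaq Λ)) (u : VSite Λ) : Prop :=
  ∃ p ∈ Q, u = p.c0 ∨ u = p.c1 ∨ u = p.c2 ∨ u = p.c3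

/-- A walk lies in the 2-complex generated by `Q` if all its vertices and edges do. -/
def WalkInComplex {Λ : Box} (Q : Set (Plaq Λ)) {u v : VSite Λ}
    (w : (latticeGraph Λ).Walk u v) : Prop :=
  (∀ x ∈ w.support, vertexInComplex Q x) ∧
  (∀ d ∈ w.darts, edgeInComplex Q d.toProd.1 d.toProd.2)

/-- One step of combinatorial homotopy of walks within the 2-complex generated by `Q`:
inserting/removing a backtracking along an edge of the complex, or inserting/removing the
boundary loop of a plaquette of the complex. -/
inductive CHStep {Λ : Box} (Q : Set (Plaq Λ)) :
    {u v : VSite Λ} → (latticeGraph Λ).Walk u v → (latticeGraph Λ).Walk u v → Prop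
  | back {u x y v : VSite Λ} (p : (latticeGraph Λ).Walk u x) (h : (latticeGraph Λ).Adj x y)
      (he : edgeInComplex Q x y) (q : (latticeGraph Λ).Walk x v) :
      CHStep Q (p.append (SimpleGraph.Walk.cons h (SimpleGraph.Walk.cons h.symm q)))
        (p.append q)
  | plaq {u v : VSite Λ} (pl : Plaq Λ) (hpl : pl ∈ Q)
      (w₁ : (latticeGraph Λ).Walk u pl.c0) (w₂ : (latticeGraph Λ).Walk pl.c0 v) :
      CHStep Q (w₁.append ((plaqWalk pl).append w₂)) (w₁.append w₂)

/-- Homotopy of walks within the 2-complex generated by `Q`. -/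
def CHomotopic {Λ : Box} (Q : Set (Plaq Λ)) {u v : VSite Λ}
    (w₁ w₂ : (latticeGraph Λ).Walk u v) : Prop :=
  Relation.EqvGen (@CHStep Λ Q u v) w₁ w₂

/-- A 2-complex (given by a plaquette set `Q`, together with all its edges and vertices)
is simply connected: it is path connected and every closed walk in it is null-homotopic
within it. -/
def SimplyConnectedC {Λ : Box} (Q : Set (Plaq Λ)) : Prop :=
  (∀ u v : VSite Λ, vertexInComplex Q u → vertexInComplex Q v →
     ∃ w : (latticeGraph Λ).Walk u v, WalkInComplex Q w) ∧
  (∀ u : VSite Λ, ∀ w : (latticeGraph Λ).Walk u u, WalkInComplex Q w →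
     CHomotopic Q w SimpleGraph.Walk.nil)

/-- The 2-complex `S₂(B)`: all plaquettes of the rectangle `B`. -/
def S2 {Λ : Box} (B : Rect Λ) : Set (Plaq Λ) := B.plaqSet

/-- A plaquette lies on the (topological) boundary of a rectangle. -/
def Plaq.onRectBoundary {Λ : Box} (B : Rect Λ) (p : Plaq Λ) : Prop :=
  B.plaqIn p ∧ ∃ k : Fin 4, k ≠ p.1.2.1 ∧ k ≠ p.1.2.2 ∧
    (p.1.1 k = B.lo k ∨ p.1.1 k = B.hi k)

/-- A plaquette lies on the boundary of the lattice `Λ`. -/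
def Plaq.onBoxBoundary {Λ : Box} (p : Plaq Λ) : Prop :=
  ∃ k : Fin 4, k ≠ p.1.2.1 ∧ k ≠ p.1.2.2 ∧ (p.1.1 k = Λ.a k ∨ p.1.1 k = Λ.b k)

/-- The 2-complex `∂S₂(B)`: plaquettes on the boundary of `B` but not on the boundary of `Λ`. -/
def bS2 {Λ : Box} (B : Rect Λ) : Set (Plaq Λ) :=
  {p | p.onRectBoundary B ∧ ¬ p.onBoxBoundary}

/-- The 2-complex `S₂ᶜ(B)`: all plaquettes of `Λ` not contained in `B`, together with `∂S₂(B)`. -/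
def S2c {Λ : Box} (B : Rect Λ) : Set (Plaq Λ) :=
  {p | ¬ B.plaqIn p} ∪ bS2 B

/-- `P₁, P₂` are well separated by the rectangle `B`. -/
def WellSeparated {Λ : Box} (B : Rect Λ) (P₁ P₂ : Set (Plaq Λ)) : Prop :=
  P₁ ⊆ S2 B ∧ P₂ ⊆ S2c B ∧ ∀ p ∈ P₁ ∪ P₂, p ∉ bS2 B

/-- A good rectangle: `S₂(B)`, `S₂ᶜ(B)` and `∂S₂(B)` are all simply connected. -/
def GoodRect {Λ : Box} (B : Rect Λ) : Prop :=
  SimplyConnectedC (S2 B) ∧ SimplyConnectedC (S2c B) ∧ SimplyConnectedC (bS2 B)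

/-- `P₁` is well separated from `P₂` by some good rectangle. -/
def WellSepGood {Λ : Box} (P₁ P₂ : Set (Plaq Λ)) : Prop :=
  ∃ B : Rect Λ, GoodRect B ∧ WellSeparated B P₁ P₂

/-- Union of a list of sets. -/
def unionList {α : Type*} (Ks : List (Set α)) : Set α := {x | ∃ K ∈ Ks, x ∈ K}

/-- `Ks` is a knot decomposition of the plaquette set `P`: a maximal partition
`P = K₁ ∪ ⋯ ∪ K_m` such that each `K_i` is well separated from `K_{i+1} ∪ ⋯ ∪ K_m`
by a good rectangle. -/
structure IsKnotDecomp {Λ : Box} (P : Set (Plaq Λ)) (Ks : List (Set (Plaq Λ))) : Prop where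
  union_eq : unionList Ks = P
  nonempty : ∀ K ∈ Ks, K.Nonempty
  pairwise_disjoint : Ks.Pairwise Disjoint
  sep : ∀ (n : ℕ) (hn : n + 1 < Ks.length),
    WellSepGood (Ks.get ⟨n, Nat.lt_of_succ_lt hn⟩) (unionList (Ks.drop (n + 1)))
  maximal : ∀ K ∈ Ks, ¬ ∃ K₁ K₂ : Set (Plaq Λ), K₁.Nonempty ∧ K₂.Nonempty ∧
    Disjoint K₁ K₂ ∧ K₁ ∪ K₂ = K ∧ WellSepGood K₁ K₂

/-- The collection `𝒦` of knots: all sets appearing in the (fixed) knot decomposition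
`KD P` of some plaquette set `P`. -/
def Knots {Λ : Box} (KD : Set (Plaq Λ) → List (Set (Plaq Λ))) : Set (Set (Plaq Λ)) :=
  {K | ∃ P : Set (Plaq Λ), K ∈ KD P}

/-- `GF(T)`: edge configurations equal to `1` on every edge of the graph `T`. -/
def GF {Λ : Box} (G : Type*) [Group G] (T : SimpleGraph (VSite Λ)) :
    Set (EdgeConf Λ G) :=
  {σ | ∀ e : PEdge Λ, T.Adj e.v0 e.v1 → σ e = 1}

/-- The 1-skeleton of the 2-complex generated by the plaquette set `Q`, as a graph. -/
def skel {Λ : Box} (Q : Set (Plaq Λ)) : SimpleGraph (VSite Λ) :=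
  SimpleGraph.fromRel (edgeInComplex Q)

/-- `T` is a spanning tree of the 1-skeleton `S₁(Λ)`. -/
def IsSpanningTree {Λ : Box} (T : SimpleGraph (VSite Λ)) : Prop :=
  T ≤ latticeGraph Λ ∧ T.IsTree

/-- `T` contains a spanning tree of the 2-complex generated by `Q`: any two vertices of the
complex are joined by a path using only edges lying both in `T` and in the complex. -/
def ContainsSpanningTreeOf {Λ : Box} (T : SimpleGraph (VSite Λ)) (Q : Set (Plaq Λ)) : Prop :=
  ∀ u v : VSite Λ, vertexInComplex Q u → vertexInComplex Q v → (T ⊓ skel Q).Reachable u v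

section Phi

variable (Λ : Box) (x₀ : VSite Λ) {G : Type*} [Group G]

/-- `supp_{P₀}(ψ₁, ψ₂) = supp(ψ₁) ∪ supp(ψ₂) ∪ P₀`. -/
def supp2 (ℓb : ∀ x : VSite Λ, (latticeGraph Λ).Walk x₀ x) (P₀ : Set (Plaq Λ))
    (ψ₁ ψ₂ : Hom Λ x₀ G) : Set (Plaq Λ) :=
  hsupp ψ₁ ℓb ∪ hsupp ψ₂ ℓb ∪ P₀

/-- The polymer counting function
`Φ²_{P₀}(P) = Σ_{ψ₁,ψ₂ : supp_{P₀}(ψ₁,ψ₂) = P} ∏_{p∈Λ₂} φ_β(ψ₁(ξ_p)) φ_β(ψ₂(ξ_p))`. -/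
def Phi2 (χ : G → ℂ) (β : ℝ) (ℓb : ∀ x : VSite Λ, (latticeGraph Λ).Walk x₀ x)
    (P₀ P : Set (Plaq Λ)) : ℝ :=
  ∑ᶠ pr : Hom Λ x₀ G × Hom Λ x₀ G,
    if supp2 Λ x₀ ℓb P₀ pr.1 pr.2 = P then
      ∏ᶠ p : Plaq Λ, phiB χ β (evalP pr.1 ℓb p) * phiB χ β (evalP pr.2 ℓb p)
    else 0

end Phi


section Swap

variable (Λ : Box) (x₀ : VSite Λ) (G : Type*) [Group G]

/-- Tuples of homomorphisms subordinate to the members of a list of plaquette sets. -/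
def TupleSpace (ℓb : ∀ x : VSite Λ, (latticeGraph Λ).Walk x₀ x)
    (Ks : List (Set (Plaq Λ))) : Type _ :=
  {t : Fin Ks.length → Hom Λ x₀ G // ∀ i, hsupp (t i) ℓb ⊆ Ks.get i}

/-- `P := supp(ψ₁) ∪ supp(ψ₂) ∪ B₁ ∪ B₂` for a pair of homomorphisms. -/
def bigP (ℓb : ∀ x : VSite Λ, (latticeGraph Λ).Walk x₀ x) (B₁ B₂ : Rect Λ)
    (pr : Hom Λ x₀ G × Hom Λ x₀ G) : Set (Plaq Λ) :=
  hsupp pr.1 ℓb ∪ hsupp pr.2 ℓb ∪ S2 B₁ ∪ S2 B₂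

/-- `B₁` and `B₂` lie in different knots of the knot decomposition of
`supp(ψ₁) ∪ supp(ψ₂) ∪ B₁ ∪ B₂`. -/
def inDiffKnots (KD : Set (Plaq Λ) → List (Set (Plaq Λ)))
    (ℓb : ∀ x : VSite Λ, (latticeGraph Λ).Walk x₀ x) (B₁ B₂ : Rect Λ)
    (pr : Hom Λ x₀ G × Hom Λ x₀ G) : Prop :=
  ∃ j₁ j₂ : Fin (KD (bigP Λ x₀ G ℓb B₁ B₂ pr)).length, j₁ ≠ j₂ ∧
    S2 B₁ ⊆ (KD (bigP Λ x₀ G ℓb B₁ B₂ pr)).get j₁ ∧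
    S2 B₂ ⊆ (KD (bigP Λ x₀ G ℓb B₁ B₂ pr)).get j₂

/-- The event `E(B₁,B₂) ⊆ Ω²`. -/
def Eset (KD : Set (Plaq Λ) → List (Set (Plaq Λ)))
    (ℓb : ∀ x : VSite Λ, (latticeGraph Λ).Walk x₀ x) (B₁ B₂ : Rect Λ) :
    Set (Hom Λ x₀ G × Hom Λ x₀ G) :=
  {pr | inDiffKnots Λ x₀ G KD ℓb B₁ B₂ pr}

/-- The swapping map `T : E(B₁,B₂) → E(B₁,B₂)` (extended by the identity off `E(B₁,B₂)`):
identify `ψ₁, ψ₂` with tuples via `Θ(P)`, exchange the coordinates of the knot containing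
`B₂`, and come back via `Θ(P)⁻¹`. -/
def swapT (KD : Set (Plaq Λ) → List (Set (Plaq Λ)))
    (ℓb : ∀ x : VSite Λ, (latticeGraph Λ).Walk x₀ x)
    (Θ : ∀ P : Set (Plaq Λ),
      {ψ : Hom Λ x₀ G // hsupp ψ ℓb ⊆ P} ≃ TupleSpace Λ x₀ G ℓb (KD P))
    (B₁ B₂ : Rect Λ) (pr : Hom Λ x₀ G × Hom Λ x₀ G) : Hom Λ x₀ G × Hom Λ x₀ G :=
  if h : inDiffKnots Λ x₀ G KD ℓb B₁ B₂ pr then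
    let P := bigP Λ x₀ G ℓb B₁ B₂ pr
    let j₂ : Fin (KD P).length := h.choose_spec.choose
    let t₁ := Θ P ⟨pr.1, fun p hp =>
      Set.mem_union_left _ (Set.mem_union_left _ (Set.mem_union_left _ hp))⟩
    let t₂ := Θ P ⟨pr.2, fun p hp =>
      Set.mem_union_left _ (Set.mem_union_left _ (Set.mem_union_right _ hp))⟩
    (((Θ P).symm ⟨Function.update t₁.1 j₂ (t₂.1 j₂), by
        intro i
        rcases eq_or_ne i j₂ with hi | hi
        · subst hi; rw [Function.update_self]; exact t₂.2 j₂
        · rw [Function.update_of_ne hi]; exact t₁.2 i⟩).1,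
     ((Θ P).symm ⟨Function.update t₂.1 j₂ (t₁.1 j₂), by
        intro i
        rcases eq_or_ne i j₂ with hi | hi
        · subst hi; rw [Function.update_self]; exact t₁.2 j₂
        · rw [Function.update_of_ne hi]; exact t₂.2 i⟩).1)
  else pr

end Swap


section Walks

variable {Λ : Box} {Q : Set (Plaq Λ)}

lemma edgeInComplex.symm {u v : VSite Λ} (h : edgeInComplex Q u v) : edgeInComplex Q v u := by
  obtain ⟨p, hp, h⟩ := h
  exact ⟨p, hp, h.symm⟩

lemma edgeInComplex.left {u v : VSite Λ} (h : edgeInComplex Q u v) : vertexInComplex Q u := by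
  obtain ⟨p, hp, h⟩ := h
  refine ⟨p, hp, ?_⟩
  simp only [plaqEdges, List.mem_cons, Prod.mk.injEq, List.not_mem_nil, or_false] at h
  tauto

lemma edgeInComplex.right {u v : VSite Λ} (h : edgeInComplex Q u v) : vertexInComplex Q v :=
  h.symm.left

lemma plaqEdges_adj {p : Plaq Λ} {u v : VSite Λ} (h : (u, v) ∈ plaqEdges p) :
    (latticeGraph Λ).Adj u v := by
  simp only [plaqEdges, List.mem_cons, Prod.mk.injEq, List.not_mem_nil, or_false] at h
  rcases h with ⟨rfl, rfl⟩ | ⟨rfl, rfl⟩ | ⟨rfl, rfl⟩ | ⟨rfl, rfl⟩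
  exacts [p.adj01, p.adj12, p.adj23.symm, p.adj30.symm]

lemma edgeInComplex.adj {u v : VSite Λ} (h : edgeInComplex Q u v) : (latticeGraph Λ).Adj u v := by
  obtain ⟨p, -, h | h⟩ := h
  exacts [plaqEdges_adj h, (plaqEdges_adj h).symm]

namespace CHomotopic

lemma refl {u v : VSite Λ} (w : (latticeGraph Λ).Walk u v) : CHomotopic Q w w :=
  Relation.EqvGen.refl w

lemma symm {u v : VSite Λ} {w w' : (latticeGraph Λ).Walk u v} (h : CHomotopic Q w w') :
    CHomotopic Q w' w := Relation.EqvGen.symm _ _ h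

lemma trans {u v : VSite Λ} {w w' w'' : (latticeGraph Λ).Walk u v} (h : CHomotopic Q w w')
    (h' : CHomotopic Q w' w'') : CHomotopic Q w w'' := Relation.EqvGen.trans _ _ _ h h'

lemma append_left {u v x : VSite Λ} (a : (latticeGraph Λ).Walk u v)
    {w w' : (latticeGraph Λ).Walk v x} (h : CHomotopic Q w w') :
    CHomotopic Q (a.append w) (a.append w') := by
  induction h with
  | rel w w' h =>
    refine Relation.EqvGen.rel _ _ ?_
    cases h with
    | back p h he q =>
      simpa only [Walk.append_assoc] using CHStep.back (a.append p) h he q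
    | plaq pl hpl w₁ w₂ =>
      simpa only [Walk.append_assoc] using CHStep.plaq pl hpl (a.append w₁) w₂
  | refl w => exact refl _
  | symm _ _ _ ih => exact ih.symm
  | trans _ _ _ _ _ ih ih' => exact ih.trans ih'

lemma append_right {u v x : VSite Λ} {w w' : (latticeGraph Λ).Walk u v}
    (h : CHomotopic Q w w') (b : (latticeGraph Λ).Walk v x) :
    CHomotopic Q (w.append b) (w'.append b) := by
  induction h with
  | rel w w' h =>
    refine Relation.EqvGen.rel _ _ ?_
    cases h with
    | back p h he q =>
      simpa only [← Walk.append_assoc, Walk.cons_append] using CHStep.back p h he (q.append b)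
    | plaq pl hpl w₁ w₂ =>
      simpa only [← Walk.append_assoc] using CHStep.plaq pl hpl w₁ (w₂.append b)
  | refl w => exact refl _
  | symm _ _ _ ih => exact ih.symm
  | trans _ _ _ _ _ ih ih' => exact ih.trans ih'

lemma append {u v x : VSite Λ} {w w' : (latticeGraph Λ).Walk u v}
    {z z' : (latticeGraph Λ).Walk v x} (h : CHomotopic Q w w') (h' : CHomotopic Q z z') :
    CHomotopic Q (w.append z) (w'.append z') :=
  (h.append_right z).trans (append_left w' h')

/-- A walk along edges of the complex followed by its reverse is null-homotopic. -/
lemma append_reverse {u v : VSite Λ} (w : (latticeGraph Λ).Walk u v)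
    (hw : ∀ d ∈ w.darts, edgeInComplex Q d.toProd.1 d.toProd.2) :
    CHomotopic Q (w.append w.reverse) Walk.nil := by
  induction w with
  | nil => exact refl _
  | cons h q ih =>
    simp only [Walk.darts_cons, List.mem_cons, forall_eq_or_imp] at hw
    have h1 := append_left (Q := Q) (Walk.cons h Walk.nil)
      ((ih hw.2).append_right (Walk.cons h.symm Walk.nil))
    have h2 := CHStep.back (Q := Q) Walk.nil h hw.1 Walk.nil
    refine CHomotopic.trans ?_ (Relation.EqvGen.rel _ _ h2)
    simpa only [Walk.reverse_cons, Walk.append_assoc, Walk.cons_append, Walk.nil_append] using h1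

lemma reverse_append {u v : VSite Λ} (w : (latticeGraph Λ).Walk u v)
    (hw : ∀ d ∈ w.darts, edgeInComplex Q d.toProd.1 d.toProd.2) :
    CHomotopic Q (w.reverse.append w) Walk.nil := by
  have h := append_reverse (Q := Q) w.reverse (by
    intro d hd
    rw [Walk.darts_reverse, List.mem_reverse, List.mem_map] at hd
    obtain ⟨d', hd', rfl⟩ := hd
    exact (hw d' hd').symm)
  rwa [Walk.reverse_reverse] at h

end CHomotopic

/-- The setoid of closed walks modulo homotopy in the complex. -/
def loopSetoid (Q : Set (Plaq Λ)) (u : VSite Λ) : Setoid ((latticeGraph Λ).Walk u u) where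
  r := CHomotopic Q
  iseqv := ⟨CHomotopic.refl, CHomotopic.symm, CHomotopic.trans⟩

/-- The monoid of homotopy classes of closed walks. -/
def LoopMonoid (Q : Set (Plaq Λ)) (u : VSite Λ) : Type := Quotient (loopSetoid Q u)

/-- The class of a closed walk. -/
def LoopMonoid.mk (Q : Set (Plaq Λ)) {u : VSite Λ} (w : (latticeGraph Λ).Walk u u) :
    LoopMonoid Q u := Quotient.mk (loopSetoid Q u) w

lemma LoopMonoid.mk_eq_mk {u : VSite Λ} {w w' : (latticeGraph Λ).Walk u u} :
    LoopMonoid.mk Q w = LoopMonoid.mk Q w' ↔ CHomotopic Q w w' :=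
  Quotient.eq (r := loopSetoid Q u)

instance (u : VSite Λ) : Monoid (LoopMonoid Q u) where
  mul := Quotient.map₂ (fun w z => w.append z) fun _ _ h _ _ h' => CHomotopic.append h h'
  one := LoopMonoid.mk Q Walk.nil
  mul_assoc a b c := by
    induction a, b, c using Quotient.inductionOn₃
    exact congrArg (LoopMonoid.mk Q) (Walk.append_assoc _ _ _).symm
  one_mul a := by
    induction a using Quotient.inductionOn
    exact congrArg (LoopMonoid.mk Q) (Walk.nil_append _)
  mul_one a := by
    induction a using Quotient.inductionOn
    exact congrArg (LoopMonoid.mk Q) (Walk.append_nil _)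

lemma LoopMonoid.mk_mul_mk {u : VSite Λ} (w z : (latticeGraph Λ).Walk u u) :
    LoopMonoid.mk Q w * LoopMonoid.mk Q z = LoopMonoid.mk Q (w.append z) := rfl

lemma LoopMonoid.one_def (u : VSite Λ) : (1 : LoopMonoid Q u) = LoopMonoid.mk Q Walk.nil := rfl

/-- Closing up walks `u → x → y` and `y → v` through walks from a base point to `y` gives, up to
homotopy, the concatenation. -/
lemma homotopic_through {u x y v : VSite Λ} (a : (latticeGraph Λ).Walk u x)
    (l : (latticeGraph Λ).Walk v x) (hl : ∀ d ∈ l.darts, edgeInComplex Q d.toProd.1 d.toProd.2)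
    (b : (latticeGraph Λ).Walk x y) :
    CHomotopic Q ((a.append l.reverse).append (l.append b)) (a.append b) := by
  have := CHomotopic.append_left a ((CHomotopic.reverse_append l hl).append_right b)
  simpa only [Walk.append_assoc, Walk.nil_append] using this

/-- A complex is simply connected once it is connected and every flat connection on it is
pure gauge. -/
theorem simplyConnectedC_of_gauge
    (hconn : ∀ f : VSite Λ → Prop, (∀ u v, edgeInComplex Q u v → (f u ↔ f v)) →
      ∀ u v, vertexInComplex Q u → vertexInComplex Q v → f u → f v)
    (hgauge : ∀ (H : Type) [Group H] (σ : VSite Λ → VSite Λ → H),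
      (∀ u v, σ u v * σ v u = 1) →
      (∀ p ∈ Q, σ p.c0 p.c1 * σ p.c1 p.c2 * σ p.c2 p.c3 * σ p.c3 p.c0 = 1) →
      ∃ g : VSite Λ → H, ∀ u v, edgeInComplex Q u v → σ u v * g v = g u) :
    SimplyConnectedC Q := by
  have hreach : ∀ u v : VSite Λ, vertexInComplex Q u → vertexInComplex Q v →
      ∃ w : (latticeGraph Λ).Walk u v, WalkInComplex Q w := by
    intro u v hu hv
    have hstep : ∀ x y, edgeInComplex Q x y →
        (∃ w : (latticeGraph Λ).Walk u x, WalkInComplex Q w) →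
        ∃ w : (latticeGraph Λ).Walk u y, WalkInComplex Q w := by
      rintro x y hxy ⟨w, hw⟩
      refine ⟨w.append (Walk.cons hxy.adj Walk.nil), fun z hz => ?_, fun d hd => ?_⟩
      · rw [Walk.mem_support_append_iff] at hz
        rcases hz with hz | hz
        · exact hw.1 z hz
        · simp only [Walk.support_cons, Walk.support_nil, List.mem_cons, List.not_mem_nil,
            or_false] at hz
          rcases hz with rfl | rfl
          exacts [hxy.left, hxy.right]
      · rw [Walk.darts_append, List.mem_append] at hd
        rcases hd with hd | hd
        · exact hw.2 d hd
        · simp only [Walk.darts_cons, Walk.darts_nil, List.mem_cons, List.not_mem_nil,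
            or_false] at hd
          subst hd
          exact hxy
    exact hconn (fun x => ∃ w : (latticeGraph Λ).Walk u x, WalkInComplex Q w)
      (fun x y h => ⟨hstep x y h, hstep y x h.symm⟩) u v hu hv
      ⟨Walk.nil, by simpa using hu, by simp⟩
  refine ⟨hreach, fun u w hw => ?_⟩
  have hu : vertexInComplex Q u := hw.1 u w.start_mem_support
  have hpath : ∀ v, ∃ ℓ : vertexInComplex Q v → (latticeGraph Λ).Walk u v,
      (∀ hv, WalkInComplex Q (ℓ hv)) ∧ ∀ (hv : vertexInComplex Q v) (h : u = v),
        ℓ hv = (Walk.nil : (latticeGraph Λ).Walk u u).copy rfl h := by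
    intro v
    by_cases h : u = v
    · subst h
      exact ⟨fun _ => Walk.nil, fun _ => ⟨by simpa using hu, by simp⟩, fun _ _ => rfl⟩
    · exact ⟨fun hv => (hreach u v hu hv).choose, fun hv => (hreach u v hu hv).choose_spec,
        fun _ h' => absurd h' h⟩
  choose ℓ hℓ hℓu using hpath
  have hd : ∀ v (hv : vertexInComplex Q v), ∀ d ∈ (ℓ v hv).darts,
      edgeInComplex Q d.toProd.1 d.toProd.2 := fun v hv => (hℓ v hv).2
  let loop : ∀ {x y : VSite Λ}, vertexInComplex Q x → vertexInComplex Q y →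
      (latticeGraph Λ).Walk x y → LoopMonoid Q u := fun hx hy z =>
    LoopMonoid.mk Q (((ℓ _ hx).append z).append (ℓ _ hy).reverse)
  have loop_mul : ∀ {x y z : VSite Λ} (hx : vertexInComplex Q x) (hy : vertexInComplex Q y)
      (hz : vertexInComplex Q z) (a : (latticeGraph Λ).Walk x y) (b : (latticeGraph Λ).Walk y z),
      loop hx hy a * loop hy hz b = loop hx hz (a.append b) := by
    intro x y z hx hy hz a b
    have := homotopic_through (Q := Q) ((ℓ x hx).append a) (ℓ y hy) (hd y hy)
      (b.append (ℓ z hz).reverse)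
    rw [LoopMonoid.mk_mul_mk, LoopMonoid.mk_eq_mk]
    simpa only [Walk.append_assoc] using this
  have loop_nil : ∀ {x : VSite Λ} (hx : vertexInComplex Q x), loop hx hx Walk.nil = 1 := by
    intro x hx
    rw [LoopMonoid.one_def, LoopMonoid.mk_eq_mk, Walk.append_nil]
    exact CHomotopic.append_reverse _ (hd x hx)
  have loop_congr : ∀ {x y : VSite Λ} (hx : vertexInComplex Q x) (hy : vertexInComplex Q y)
      {a b : (latticeGraph Λ).Walk x y}, CHomotopic Q a b → loop hx hy a = loop hx hy b := by
    intro x y hx hy a b h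
    rw [LoopMonoid.mk_eq_mk]
    exact (CHomotopic.append_left _ h).append_right _
  have loop_edge : ∀ {x y : VSite Λ} (h : edgeInComplex Q x y),
      loop h.left h.right (Walk.cons h.adj Walk.nil) *
        loop h.right h.left (Walk.cons h.adj.symm Walk.nil) = 1 := by
    intro x y h
    rw [loop_mul, ← loop_nil h.left]
    exact loop_congr _ _ (Relation.EqvGen.rel _ _ (CHStep.back Walk.nil h.adj h Walk.nil))
  let σ : VSite Λ → VSite Λ → (LoopMonoid Q u)ˣ := fun x y =>
    if h : edgeInComplex Q x y then
      ⟨loop h.left h.right (Walk.cons h.adj Walk.nil),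
        loop h.right h.left (Walk.cons h.adj.symm Walk.nil), loop_edge h, loop_edge h.symm⟩
    else 1
  have σ_val : ∀ {x y : VSite Λ} (h : edgeInComplex Q x y),
      (σ x y : LoopMonoid Q u) = loop h.left h.right (Walk.cons h.adj Walk.nil) := by
    intro x y h
    simp only [σ, dif_pos h]
  have σ_symm : ∀ x y, σ x y * σ y x = 1 := by
    intro x y
    by_cases h : edgeInComplex Q x y
    · refine Units.ext ?_
      rw [Units.val_mul, σ_val h, σ_val h.symm, loop_edge h, Units.val_one]
    · have h' : ¬ edgeInComplex Q y x := fun h' => h h'.symm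
      simp only [σ, dif_neg h, dif_neg h', mul_one]
  have σ_walk : ∀ {x y : VSite Λ} (z : (latticeGraph Λ).Walk x y) (hx : vertexInComplex Q x)
      (hy : vertexInComplex Q y), (∀ d ∈ z.darts, edgeInComplex Q d.toProd.1 d.toProd.2) →
      (((z.darts.map fun d => σ d.toProd.1 d.toProd.2).prod : (LoopMonoid Q u)ˣ) :
        LoopMonoid Q u) = loop hx hy z := by
    intro x y z
    induction z with
    | nil =>
      intro hx _ _
      simp [loop_nil hx]
    | @cons a b c h q ih =>
      intro hx hy hz
      simp only [Walk.darts_cons, List.mem_cons, forall_eq_or_imp] at hz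
      rw [Walk.darts_cons, List.map_cons, List.prod_cons, Units.val_mul, σ_val hz.1,
        ih hz.1.right hy hz.2, loop_mul]
      rfl
  obtain ⟨g, hg⟩ := hgauge _ σ σ_symm (by
    intro p hp
    have hv : vertexInComplex Q p.c0 := ⟨p, hp, Or.inl rfl⟩
    have h := σ_walk (plaqWalk p) hv hv (by
      intro d hd
      refine ⟨p, hp, ?_⟩
      simp only [plaqWalk, Walk.darts_cons, Walk.darts_nil, List.mem_cons, List.not_mem_nil,
        or_false] at hd
      rcases hd with rfl | rfl | rfl | rfl <;> simp [plaqEdges])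
    have h1 : loop hv hv (plaqWalk p) = loop hv hv Walk.nil := by
      refine loop_congr _ _ (Relation.EqvGen.rel _ _ ?_)
      simpa only [Walk.append_nil, Walk.nil_append] using
        CHStep.plaq (Q := Q) p hp Walk.nil Walk.nil
    rw [h1, loop_nil] at h
    refine Units.ext ?_
    rw [← Units.val_one] at h
    rw [← h]
    simp [plaqWalk, mul_assoc])
  have tele : ∀ {x y : VSite Λ} (z : (latticeGraph Λ).Walk x y),
      (∀ d ∈ z.darts, edgeInComplex Q d.toProd.1 d.toProd.2) →
      (z.darts.map fun d => σ d.toProd.1 d.toProd.2).prod * g y = g x := by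
    intro x y z
    induction z with
    | nil => intro _; simp
    | @cons a b c h q ih =>
      intro hz
      simp only [Walk.darts_cons, List.mem_cons, forall_eq_or_imp] at hz
      rw [Walk.darts_cons, List.map_cons, List.prod_cons, mul_assoc, ih hz.2, hg _ _ hz.1]
  have h1 := σ_walk w hu hu hw.2
  rw [mul_eq_right.mp (tele w hw.2), Units.val_one, LoopMonoid.one_def] at h1
  have h2 := LoopMonoid.mk_eq_mk.mp h1
  rw [hℓu u hu rfl] at h2
  simpa using h2.symm

end Walks

section Gauge

variable {H : Type*} [Group H]

lemma unit_apply (i j : Fin 4) : unit i j = if j = i then 1 else 0 := rfl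

lemma unit_apply_of_ne {i j : Fin 4} (h : j ≠ i) : unit i j = 0 := if_neg h

/-- The box of sites between two opposite corners. -/
def siteBox (lo hi : Site) : Set Site := {x | ∀ i, lo i ≤ x i ∧ x i ≤ hi i}

/-- The flatness of the connection `s` at the plaquette based at `x` in directions `i, j`. -/
def FlatAt (s : Site → Fin 4 → H) (x : Site) (i j : Fin 4) : Prop :=
  s x i * s (x + unit i) j = s x j * s (x + unit j) i

lemma FlatAt.symm {s : Site → Fin 4 → H} {x : Site} {i j : Fin 4} (h : FlatAt s x i j) :
    FlatAt s x j i := Eq.symm h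

/-- The gauge transformation `g` trivializes the connection `s` along the edges inside `A`. -/
def TrivialOn (s : Site → Fin 4 → H) (g : Site → H) (A : Set Site) : Prop :=
  ∀ x i, x ∈ A → x + unit i ∈ A → s x i * g (x + unit i) = g x

/-- A trivialization on the slice `x j = c` extends to layers around it. -/
lemma TrivialOn.exists_extend {s : Site → Fin 4 → H} {A : Set Site} {j : Fin 4} {c : ℤ}
    (hup : ∀ x ∈ A, c < x j → x - unit j ∈ A) (hdown : ∀ x ∈ A, x j < c → x + unit j ∈ A)
    (hflat : ∀ x i, i ≠ j → x ∈ A → x + unit i + unit j ∈ A → FlatAt s x i j)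
    (h : ∃ g, TrivialOn s g {x | x ∈ A ∧ x j = c}) (m : ℕ) :
    ∃ g, TrivialOn s g {x | x ∈ A ∧ |x j - c| ≤ m} := by
  induction m with
  | zero =>
    obtain ⟨g, hg⟩ := h
    refine ⟨g, fun x i hx hxi => hg x i ⟨hx.1, ?_⟩ ⟨hxi.1, ?_⟩⟩
    · have := hx.2
      simp only [Nat.cast_zero, abs_nonpos_iff] at this
      omega
    · have := hxi.2
      simp only [Nat.cast_zero, abs_nonpos_iff] at this
      omega
  | succ m ih =>
    obtain ⟨g, hg⟩ := ih
    refine ⟨fun x => if x j = c + m + 1 then (s (x - unit j) j)⁻¹ * g (x - unit j)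
      else if x j = c - m - 1 then s x j * g (x + unit j) else g x, ?_⟩
    rintro x i ⟨hxA, hx⟩ ⟨hyA, hy⟩
    rw [abs_le] at hx hy
    push_cast at hx hy
    rcases eq_or_ne i j with rfl | hij
    · have hxi : (x + unit i) i = x i + 1 := by rw [Pi.add_apply, unit_apply_self]
      rw [hxi] at hy
      simp only [hxi, add_sub_cancel_right]
      by_cases h1 : x i = c + m
      · rw [if_pos (by omega), if_neg (by omega), if_neg (by omega), mul_inv_cancel_left]
      · by_cases h2 : x i = c - m - 1
        · rw [if_neg (by omega), if_neg (by omega), if_neg (by omega), if_pos h2]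
        · rw [if_neg (by omega), if_neg (by omega), if_neg (by omega), if_neg h2]
          refine hg x i ⟨hxA, abs_le.mpr ⟨by omega, by omega⟩⟩ ⟨hyA, ?_⟩
          rw [hxi]
          exact abs_le.mpr ⟨by omega, by omega⟩
    · have hxi : (x + unit i) j = x j := by
        rw [Pi.add_apply, unit_apply_of_ne hij.symm, add_zero]
      simp only [hxi]
      by_cases h1 : x j = c + m + 1
      · rw [if_pos h1, if_pos h1]
        obtain ⟨y, rfl⟩ : ∃ y, x = y + unit j := ⟨x - unit j, (sub_add_cancel _ _).symm⟩
        have hyj : (y + unit j) j = y j + 1 := by rw [Pi.add_apply, unit_apply_self]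
        have hyi : (y + unit i) j = y j := by
          rw [Pi.add_apply, unit_apply_of_ne hij.symm, add_zero]
        have e1 : y + unit j + unit i - unit j = y + unit i := by abel
        have hy1 := hup _ hxA (by omega)
        have hy2 := hup _ hyA (by omega)
        rw [add_sub_cancel_right] at hy1
        rw [e1] at hy2
        rw [add_sub_cancel_right, e1]
        have hf := hflat y i hij hy1 (by rwa [add_right_comm])
        have hgy := hg y i ⟨hy1, abs_le.mpr ⟨by omega, by omega⟩⟩
          ⟨hy2, abs_le.mpr ⟨by omega, by omega⟩⟩
        rw [FlatAt, ← eq_mul_inv_iff_mul_eq, mul_assoc] at hf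
        rw [← hgy, hf]
        group
      · by_cases h2 : x j = c - m - 1
        · rw [if_neg h1, if_neg h1, if_pos h2, if_pos h2]
          have hxj : (x + unit j) j = x j + 1 := by rw [Pi.add_apply, unit_apply_self]
          have hxji : (x + unit j + unit i) j = x j + 1 := by
            rw [Pi.add_apply, hxj, unit_apply_of_ne hij.symm, add_zero]
          have hy1 := hdown _ hxA (by omega)
          have hy2 := hdown _ hyA (by omega)
          have hf := hflat x i hij hxA hy2
          rw [add_right_comm] at hy2 ⊢
          have hgy := hg (x + unit j) i ⟨hy1, abs_le.mpr ⟨by omega, by omega⟩⟩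
            ⟨hy2, abs_le.mpr ⟨by omega, by omega⟩⟩
          rw [← hgy, ← mul_assoc, ← mul_assoc, hf]
        · rw [if_neg h1, if_neg h1, if_neg h2, if_neg h2]
          refine hg x i ⟨hxA, abs_le.mpr ⟨by omega, by omega⟩⟩ ⟨hyA, ?_⟩
          rw [hxi]
          exact abs_le.mpr ⟨by omega, by omega⟩

/-- A flat connection on a box is pure gauge.  It is enough to have flatness at the plaquettes
extending in a chosen direction `j` and at those in the slice of the box through a site `c`. -/
theorem exists_trivialOn_siteBox {s : Site → Fin 4 → H} {lo hi c : Site} (hc : c ∈ siteBox lo hi)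
    (j : Fin 4)
    (h1 : ∀ x i, i ≠ j → x ∈ siteBox lo hi → x + unit i + unit j ∈ siteBox lo hi → FlatAt s x i j)
    (h2 : ∀ x i k, i ≠ k → i ≠ j → k ≠ j → x j = c j → x ∈ siteBox lo hi →
      x + unit i + unit k ∈ siteBox lo hi → FlatAt s x i k) :
    ∃ g, TrivialOn s g (siteBox lo hi) := by
  have step : ∀ (D : Finset (Fin 4)) (k : Fin 4), k ∉ D →
      (∀ x i, i ≠ k → i ∈ D → x ∈ siteBox lo hi → (∀ l ∉ insert k D, x l = c l) →
        x + unit i + unit k ∈ siteBox lo hi → FlatAt s x i k) →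
      (∃ g, TrivialOn s g {x | x ∈ siteBox lo hi ∧ ∀ l ∉ D, x l = c l}) →
      ∃ g, TrivialOn s g {x | x ∈ siteBox lo hi ∧ ∀ l ∉ insert k D, x l = c l} := by
    intro D k hk hflat hg
    have hext := TrivialOn.exists_extend (s := s) (c := c k) (j := k)
      (A := {x | x ∈ siteBox lo hi ∧ ∀ l ∉ insert k D, x l = c l}) ?_ ?_ ?_ ?_
      (|hi k - c k| + |lo k - c k|).toNat
    · obtain ⟨g, hg⟩ := hext
      have hle : ∀ x ∈ siteBox lo hi,
          |x k - c k| ≤ ((|hi k - c k| + |lo k - c k|).toNat : ℤ) := by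
        intro x hx
        have := hx k
        rw [Int.toNat_of_nonneg (by positivity)]
        rcases abs_cases (x k - c k) with h | h <;> rcases abs_cases (hi k - c k) with h' | h' <;>
          rcases abs_cases (lo k - c k) with h'' | h'' <;> omega
      exact ⟨g, fun x i hx hxi => hg x i ⟨hx, hle x hx.1⟩ ⟨hxi, hle _ hxi.1⟩⟩
    · rintro x ⟨hx, hxD⟩ hlt
      refine ⟨fun l => ?_, fun l hl => ?_⟩
      · have := hx l
        have := hc l
        rw [Pi.sub_apply, unit_apply]
        split_ifs with h
        · subst h; omega
        · omega
      · have : l ≠ k := fun h => hl (h ▸ Finset.mem_insert_self _ _)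
        rw [Pi.sub_apply, unit_apply_of_ne this, sub_zero, hxD l hl]
    · rintro x ⟨hx, hxD⟩ hlt
      refine ⟨fun l => ?_, fun l hl => ?_⟩
      · have := hx l
        have := hc l
        rw [Pi.add_apply, unit_apply]
        split_ifs with h
        · subst h; omega
        · omega
      · have : l ≠ k := fun h => hl (h ▸ Finset.mem_insert_self _ _)
        rw [Pi.add_apply, unit_apply_of_ne this, add_zero, hxD l hl]
    · rintro x i hik ⟨hx, hxD⟩ ⟨hy, hyD⟩
      refine hflat x i hik ?_ hx hxD hy
      by_contra hi
      have hi' : i ∉ insert k D := by simp [hik, hi]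
      have e1 := hxD i hi'
      have e2 := hyD i hi'
      rw [Pi.add_apply, Pi.add_apply, unit_apply_self, unit_apply_of_ne hik] at e2
      omega
    · obtain ⟨g, hg⟩ := hg
      have hsub : ∀ x, (x ∈ siteBox lo hi ∧ ∀ l ∉ insert k D, x l = c l) ∧ x k = c k →
          x ∈ siteBox lo hi ∧ ∀ l ∉ D, x l = c l := by
        rintro x ⟨⟨hx, hxD⟩, hxk⟩
        refine ⟨hx, fun l hl => ?_⟩
        by_cases hlk : l = k
        · rw [hlk, hxk]
        · exact hxD l (by simp [hlk, hl])
      exact ⟨g, fun x i hx hxi => hg x i (hsub x hx) (hsub _ hxi)⟩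
  have hD : ∀ D : Finset (Fin 4), j ∉ D →
      ∃ g, TrivialOn s g {x | x ∈ siteBox lo hi ∧ ∀ l ∉ D, x l = c l} := by
    intro D
    induction D using Finset.induction_on with
    | empty =>
      intro _
      refine ⟨1, ?_⟩
      rintro x i ⟨-, hx⟩ ⟨-, hy⟩
      have e1 := hx i (by simp)
      have e2 := hy i (by simp)
      rw [Pi.add_apply, unit_apply_self] at e2
      omega
    | insert k D hk ih =>
      intro hj
      have hjk : j ≠ k := fun h => hj (h ▸ Finset.mem_insert_self _ _)
      have hjD : j ∉ D := fun h => hj (Finset.mem_insert_of_mem h)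
      refine step D k hk (fun x i hik hiD hx hxD hy => ?_) (ih hjD)
      exact h2 x i k hik (fun h => hjD (h ▸ hiD)) hjk.symm (hxD j hj) hx hy
  obtain ⟨g, hg⟩ := step (Finset.univ.erase j) j (by simp)
    (fun x i hij _ hx _ hy => h1 x i hij hx hy) (hD _ (by simp))
  refine ⟨g, fun x i hx hy => hg x i ⟨hx, ?_⟩ ⟨hy, ?_⟩⟩ <;> simp

/-- A set of sites is connected through its nearest-neighbour edges. -/
def EdgeConn (A : Set Site) : Prop :=
  ∀ f : Site → Prop, (∀ x i, x ∈ A → x + unit i ∈ A → (f x ↔ f (x + unit i))) →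
    ∀ x ∈ A, ∀ y ∈ A, f x → f y

lemma EdgeConn.eq {α : Type*} {A : Set Site} (hA : EdgeConn A) {f : Site → α}
    (hf : ∀ x i, x ∈ A → x + unit i ∈ A → f x = f (x + unit i)) {x y : Site} (hx : x ∈ A)
    (hy : y ∈ A) : f x = f y :=
  (hA (fun z => f z = f x) (fun z i hz hzi => by rw [hf z i hz hzi]) x hx y hy rfl).symm

lemma edgeConn_siteBox (lo hi : Site) : EdgeConn (siteBox lo hi) := by
  intro f hf
  have key : ∀ (n : ℕ) (x : Site), x ∈ siteBox lo hi → ∑ i, (x i - lo i) = n → (f x ↔ f lo) := by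
    intro n
    induction n with
    | zero =>
      intro x hx h0
      have : x = lo := by
        funext i
        have := (Finset.sum_eq_zero_iff_of_nonneg
          (fun i _ => sub_nonneg.mpr (hx i).1)).mp h0 i (Finset.mem_univ i)
        omega
      rw [this]
    | succ n ih =>
      intro x hx hn
      obtain ⟨i, hlt⟩ : ∃ i, lo i < x i := by
        by_contra! h
        have : ∑ i, (x i - lo i) ≤ 0 := Finset.sum_nonpos fun i _ => sub_nonpos.mpr (h i)
        push_cast at hn
        omega
      have hx' : x - unit i ∈ siteBox lo hi := by
        intro l
        have := hx l
        rw [Pi.sub_apply, unit_apply]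
        split_ifs with h
        · subst h; omega
        · omega
      have hs : ∑ l, ((x - unit i) l - lo l) = n := by
        have : ∑ l, ((x - unit i) l - lo l) = ∑ l, (x l - lo l) - ∑ l, unit i l := by
          rw [← Finset.sum_sub_distrib]
          exact Finset.sum_congr rfl fun l _ => by rw [Pi.sub_apply]; ring
        rw [this, hn]
        simp [unit]
      rw [← ih _ hx' hs]
      have := hf (x - unit i) i hx' (by rwa [sub_add_cancel])
      rw [sub_add_cancel] at this
      exact this.symm
  intro x hx y hy hfx
  have hnn : ∀ z ∈ siteBox lo hi, ∑ i, (z i - lo i) = ((∑ i, (z i - lo i)).toNat : ℤ) :=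
    fun z hz => (Int.toNat_of_nonneg (Finset.sum_nonneg fun i _ => sub_nonneg.mpr (hz i).1)).symm
  exact (key _ y hy (hnn y hy)).mpr ((key _ x hx (hnn x hx)).mp hfx)

/-- Trivializations on sets overlapping in a connected way can be glued. -/
lemma TrivialOn.exists_glue {ι : Type*} {s : Site → Fin 4 → H} {J : Set ι} {R : ι → Set Site}
    {A : Set Site} {g₁ g₂ : Site → H} (h₁ : ∀ β ∈ J, TrivialOn s g₁ (R β)) (h₂ : TrivialOn s g₂ A)
    (hconn : ∀ f : Site → H,
      (∀ β ∈ J, ∀ x i, x ∈ A ∩ R β → x + unit i ∈ A ∩ R β → f x = f (x + unit i)) →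
      ∀ β ∈ J, ∀ β' ∈ J, ∀ x ∈ A ∩ R β, ∀ y ∈ A ∩ R β', f x = f y) :
    ∃ g, TrivialOn s g A ∧ ∀ β ∈ J, TrivialOn s g (R β) := by
  have hf := hconn (fun x => (g₂ x)⁻¹ * g₁ x) (by
    intro β hβ x i hx hxi
    rw [← h₁ β hβ x i hx.2 hxi.2, ← h₂ x i hx.1 hxi.1]
    group)
  obtain ⟨h, hh⟩ : ∃ h : H, ∀ β ∈ J, ∀ x ∈ A ∩ R β, g₂ x * h = g₁ x := by
    by_cases hne : ∃ β ∈ J, ∃ x, x ∈ A ∩ R β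
    · obtain ⟨β₀, hβ₀, x₀, hx₀⟩ := hne
      refine ⟨(g₂ x₀)⁻¹ * g₁ x₀, fun β hβ x hx => ?_⟩
      rw [hf β₀ hβ₀ β hβ x₀ hx₀ x hx, mul_inv_cancel_left]
    · push Not at hne
      exact ⟨1, fun β hβ x hx => absurd hx (hne β hβ x)⟩
  refine ⟨fun x => if x ∈ A then g₂ x * h else g₁ x, fun x i hx hxi => ?_,
    fun β hβ x i hx hxi => ?_⟩
  · simp only [if_pos hx, if_pos hxi, ← mul_assoc, h₂ x i hx hxi]
  · have hg : ∀ z ∈ R β, (if z ∈ A then g₂ z * h else g₁ z) = g₁ z := by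
      intro z hz
      split_ifs with hzA
      · exact hh β hβ z ⟨hzA, hz⟩
      · rfl
    simp only [hg _ hx, hg _ hxi, h₁ β hβ x i hx hxi]

/-- A family of sets of sites overlapping like (some of) the facets of a four-dimensional cube,
with at least one facet in each direction. -/
structure CubeCover (I : Set (Fin 4 × Bool)) (R : Fin 4 × Bool → Set Site) : Prop where
  dir : ∀ k, ∃ b, (k, b) ∈ I
  conn : ∀ α ∈ I, ∀ β ∈ I, EdgeConn (R α ∩ R β)
  inter : ∀ α ∈ I, ∀ β ∈ I, ∀ γ ∈ I, α.1 ≠ β.1 → α.1 ≠ γ.1 → β.1 ≠ γ.1 →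
    (R α ∩ R β ∩ R γ).Nonempty
  disj : ∀ α ∈ I, ∀ β ∈ I, α.1 = β.1 → α ≠ β → Disjoint (R α) (R β)

namespace CubeCover

variable {I : Set (Fin 4 × Bool)} {R : Fin 4 × Bool → Set Site}

lemma exists_dir_ne (hR : CubeCover I R) (k l : Fin 4) : ∃ γ ∈ I, γ.1 ≠ k ∧ γ.1 ≠ l := by
  obtain ⟨m, hm⟩ : ∃ m : Fin 4, m ≠ k ∧ m ≠ l := by revert k l; decide
  obtain ⟨b, hb⟩ := hR.dir m
  exact ⟨(m, b), hb, hm⟩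

lemma inter_nonempty (hR : CubeCover I R) {α β : Fin 4 × Bool} (hα : α ∈ I) (hβ : β ∈ I)
    (h : α.1 ≠ β.1) : (R α ∩ R β).Nonempty := by
  obtain ⟨γ, hγ, h1, h2⟩ := hR.exists_dir_ne α.1 β.1
  exact (hR.inter α hα β hβ γ hγ h h1.symm h2.symm).mono Set.inter_subset_left

lemma edgeConn (hR : CubeCover I R) {α : Fin 4 × Bool} (hα : α ∈ I) : EdgeConn (R α) := by
  simpa using hR.conn α hα α hα

/-- The union of the family is connected. -/
lemma forall_imp (hR : CubeCover I R) {f : Site → Prop}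
    (hf : ∀ α ∈ I, ∀ x i, x ∈ R α → x + unit i ∈ R α → (f x ↔ f (x + unit i))) :
    ∀ α ∈ I, ∀ β ∈ I, ∀ x ∈ R α, ∀ y ∈ R β, f x → f y := by
  have h1 : ∀ α ∈ I, ∀ β ∈ I, α.1 ≠ β.1 → ∀ x ∈ R α, ∀ y ∈ R β, f x → f y := by
    intro α hα β hβ hne x hx y hy hfx
    obtain ⟨z, hzα, hzβ⟩ := hR.inter_nonempty hα hβ hne
    exact hR.edgeConn hβ f (hf β hβ) z hzβ y hy (hR.edgeConn hα f (hf α hα) x hx z hzα hfx)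
  intro α hα β hβ x hx y hy hfx
  obtain ⟨γ, hγ, hγα, hγβ⟩ := hR.exists_dir_ne α.1 β.1
  obtain ⟨z, -, hz⟩ := hR.inter_nonempty hα hγ hγα.symm
  exact h1 γ hγ β hβ hγβ z hz y hy (h1 α hα γ hγ hγα.symm x hx z hz hfx)

lemma exists_insert (hR : CubeCover I R) {s : Site → Fin 4 → H} {J : Set (Fin 4 × Bool)}
    (hJ : J ⊆ I) {α : Fin 4 × Bool} (hα : α ∈ I) (hαJ : α ∉ J)
    (hlink : ∀ β ∈ J, ∀ β' ∈ J, β.1 ≠ α.1 → β.1 = β'.1 → β ≠ β' →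
      ∃ γ ∈ J, γ.1 ≠ α.1 ∧ γ.1 ≠ β.1)
    (h₁ : ∃ g, ∀ β ∈ J, TrivialOn s g (R β)) (h₂ : ∃ g, TrivialOn s g (R α)) :
    ∃ g, ∀ β ∈ insert α J, TrivialOn s g (R β) := by
  obtain ⟨g₁, h₁⟩ := h₁
  obtain ⟨g₂, h₂⟩ := h₂
  have := TrivialOn.exists_glue h₁ h₂ (by
    intro f hf
    have hne : ∀ β ∈ J, ∀ x ∈ R α ∩ R β, β.1 ≠ α.1 := by
      intro β hβ x hx h
      exact Set.disjoint_left.mp (hR.disj β (hJ hβ) α hα h fun h' => hαJ (h' ▸ hβ)) hx.2 hx.1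
    have h1 : ∀ β ∈ J, ∀ β' ∈ J, β.1 ≠ β'.1 → ∀ x ∈ R α ∩ R β, ∀ y ∈ R α ∩ R β', f x = f y := by
      intro β hβ β' hβ' hββ' x hx y hy
      obtain ⟨z, ⟨hzα, hzβ⟩, hzβ'⟩ := hR.inter α hα β (hJ hβ) β' (hJ hβ') (hne β hβ x hx).symm
        (hne β' hβ' y hy).symm hββ'
      exact ((hR.conn α hα β (hJ hβ)).eq (hf β hβ) hx ⟨hzα, hzβ⟩).trans
        ((hR.conn α hα β' (hJ hβ')).eq (hf β' hβ') ⟨hzα, hzβ'⟩ hy)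
    intro β hβ β' hβ' x hx y hy
    by_cases hdir : β.1 = β'.1
    · by_cases heq : β = β'
      · subst heq
        exact (hR.conn α hα β (hJ hβ)).eq (hf β hβ) hx hy
      · obtain ⟨γ, hγ, hγα, hγβ⟩ := hlink β hβ β' hβ' (hne β hβ x hx) hdir heq
        obtain ⟨z, hz⟩ := hR.inter_nonempty hα (hJ hγ) hγα.symm
        exact (h1 β hβ γ hγ hγβ.symm x hx z hz).trans (h1 γ hγ β' hβ' (hdir ▸ hγβ) z hz y hy)
    · exact h1 β hβ β' hβ' hdir x hx y hy)
  obtain ⟨g, hg, hg'⟩ := this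
  exact ⟨g, Set.forall_mem_insert.mpr ⟨hg, hg'⟩⟩

/-- A connection trivial on each member of the family is trivial on their union. -/
theorem exists_trivialOn (hR : CubeCover I R) {s : Site → Fin 4 → H}
    (h : ∀ α ∈ I, ∃ g, TrivialOn s g (R α)) : ∃ g, ∀ α ∈ I, TrivialOn s g (R α) := by
  obtain ⟨b, hb⟩ := hR.dir 0
  have hside : ∀ S : Finset (Fin 4 × Bool), (∀ β ∈ S, β ∈ I ∧ β.1 ≠ 0) →
      ∃ g, ∀ β ∈ insert (0, b) (S : Set (Fin 4 × Bool)), TrivialOn s g (R β) := by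
    intro S
    induction S using Finset.induction_on with
    | empty =>
      intro _
      obtain ⟨g, hg⟩ := h _ hb
      exact ⟨g, by simpa using hg⟩
    | insert α S hα ih =>
      intro hS
      rw [Finset.forall_mem_insert] at hS
      have := hR.exists_insert (J := insert (0, b) (S : Set (Fin 4 × Bool)))
        (Set.insert_subset hb fun β hβ => (hS.2 β hβ).1) hS.1.1
        (by
          rintro (h' | h')
          · exact hS.1.2 (by rw [h'])
          · exact hα h')
        (by
          intro β hβ β' hβ' _ hdir hne
          refine ⟨(0, b), Set.mem_insert _ _, hS.1.2.symm, fun h0 => ?_⟩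
          have h0 : β.1 = 0 := h0.symm
          have e : ∀ δ ∈ insert (0, b) (S : Set (Fin 4 × Bool)), δ.1 = 0 → δ = (0, b) := by
            rintro δ (hδ | hδ) hδ0
            · exact hδ
            · exact absurd hδ0 (hS.2 δ hδ).2
          exact hne ((e β hβ h0).trans (e β' hβ' (hdir ▸ h0)).symm))
        (ih hS.2) (h α hS.1.1)
      rw [Finset.coe_insert, Set.insert_comm]
      exact this
  obtain ⟨g, hg⟩ := hside (Finset.univ.filter fun β => β ∈ I ∧ β.1 ≠ 0) (by simp)
  have hcover : ∀ β ∈ I, β ≠ (0, !b) → β ∈ insert (0, b)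
      ((Finset.univ.filter fun β => β ∈ I ∧ β.1 ≠ 0 : Finset (Fin 4 × Bool)) :
        Set (Fin 4 × Bool)) := by
    rintro ⟨k, b'⟩ hβ hne
    by_cases hk : k = 0
    · subst hk
      left
      have : b' ≠ !b := fun h => hne (by rw [h])
      rw [show b' = b by cases b <;> cases b' <;> simp_all]
    · right
      simpa using ⟨hβ, hk⟩
  by_cases hb' : (0, !b) ∈ I
  · obtain ⟨g', hg'⟩ := hR.exists_insert (α := (0, !b)) (J := insert (0, b)
      ((Finset.univ.filter fun β => β ∈ I ∧ β.1 ≠ 0 : Finset (Fin 4 × Bool)) :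
        Set (Fin 4 × Bool))) (s := s)
      (Set.insert_subset hb fun β hβ => by simp at hβ; exact hβ.1) hb'
      (by simp)
      (by
        intro β _ β' _ _ _ _
        obtain ⟨γ, hγ, h1, h2⟩ := hR.exists_dir_ne 0 β.1
        exact ⟨γ, hcover γ hγ (fun h => h1 (by rw [h])), h1, h2⟩)
      ⟨g, hg⟩ (h _ hb')
    refine ⟨g', fun α hα => hg' α ?_⟩
    by_cases hα' : α = (0, !b)
    · exact hα' ▸ Set.mem_insert _ _
    · exact Set.mem_insert_of_mem _ (hcover α hα hα')
  · exact ⟨g, fun α hα => hg α (hcover α hα fun h => hb' (h ▸ hα))⟩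

end CubeCover

end Gauge

section Planes

variable {Λ : Box} {Q : Set (Plaq Λ)}

/-- The plaquette set `Q` has a plaquette based at `x` in directions `i, j`, in some order. -/
def PlaqMem (Q : Set (Plaq Λ)) (x : Site) (i j : Fin 4) : Prop :=
  ∃ p ∈ Q, p.1 = (x, i, j) ∨ p.1 = (x, j, i)

lemma PlaqMem.symm {x : Site} {i j : Fin 4} (h : PlaqMem Q x i j) : PlaqMem Q x j i := by
  obtain ⟨p, hp, h⟩ := h
  exact ⟨p, hp, h.symm⟩

/-- The edge from `x` in direction `i` bounds a plaquette of `Q`. -/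
def EdgeMem (Q : Set (Plaq Λ)) (x : Site) (i : Fin 4) : Prop :=
  ∃ j, PlaqMem Q x i j ∨ ∃ y, x = y + unit j ∧ PlaqMem Q y i j

lemma PlaqMem.edgeMem {x : Site} {i j : Fin 4} (h : PlaqMem Q x i j) : EdgeMem Q x i :=
  ⟨j, Or.inl h⟩

lemma PlaqMem.edgeMem_add {x : Site} {i j : Fin 4} (h : PlaqMem Q x i j) :
    EdgeMem Q (x + unit j) i :=
  ⟨j, Or.inr ⟨x, rfl, h⟩⟩

lemma EdgeMem.exists_edgeInComplex {x : Site} {i : Fin 4} (h : EdgeMem Q x i) :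
    ∃ (h₁ : Λ.mem x) (h₂ : Λ.mem (x + unit i)),
      edgeInComplex Q ⟨x, h₁⟩ ⟨x + unit i, h₂⟩ := by
  obtain ⟨j, ⟨p, hp, h | h⟩ | ⟨y, rfl, p, hp, h | h⟩⟩ := h
  all_goals
    obtain ⟨⟨y, k, l⟩, hkl, h0, h1, h2, h3⟩ := p
    simp only [Prod.mk.injEq] at h
    obtain ⟨rfl, rfl, rfl⟩ := h
  · exact ⟨h0, h1, _, hp, Or.inl (by simp [plaqEdges, Plaq.c0, Plaq.c1])⟩
  · exact ⟨h0, h3, _, hp, Or.inl (by simp [plaqEdges, Plaq.c0, Plaq.c3])⟩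
  · exact ⟨h3, by rwa [add_right_comm], _, hp,
      Or.inl (by simp [plaqEdges, Plaq.c3, Plaq.c2, add_right_comm])⟩
  · exact ⟨h1, h2, _, hp, Or.inl (by simp [plaqEdges, Plaq.c1, Plaq.c2])⟩

lemma exists_edgeMem_of_mem_plaqEdges {p : Plaq Λ} (hp : p ∈ Q) {u v : VSite Λ}
    (h : (u, v) ∈ plaqEdges p) : ∃ i, (v : Site) = u + unit i ∧ EdgeMem Q u i := by
  have h0 : PlaqMem Q p.1.1 p.1.2.1 p.1.2.2 := ⟨p, hp, Or.inl rfl⟩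
  simp only [plaqEdges, List.mem_cons, Prod.mk.injEq, List.not_mem_nil, or_false] at h
  rcases h with ⟨rfl, rfl⟩ | ⟨rfl, rfl⟩ | ⟨rfl, rfl⟩ | ⟨rfl, rfl⟩
  · exact ⟨_, rfl, h0.edgeMem⟩
  · exact ⟨_, rfl, h0.symm.edgeMem_add⟩
  · exact ⟨_, add_right_comm _ _ _, h0.edgeMem_add⟩
  · exact ⟨_, rfl, h0.symm.edgeMem⟩

/-- A connected plaquette set on which every flat connection is pure gauge is simply
connected. -/
theorem simplyConnectedC_of_flat
    (hconn : ∀ f : Site → Prop, (∀ x i, EdgeMem Q x i → (f x ↔ f (x + unit i))) →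
      ∀ x i j y k l, PlaqMem Q x i j → PlaqMem Q y k l → f x → f y)
    (hgauge : ∀ (H : Type) [Group H] (s : Site → Fin 4 → H),
      (∀ x i j, PlaqMem Q x i j → FlatAt s x i j) →
      ∃ g : Site → H, ∀ x i, EdgeMem Q x i → s x i * g (x + unit i) = g x) :
    SimplyConnectedC Q := by
  refine simplyConnectedC_of_gauge (fun f hf u v hu hv hfu => ?_) (fun H _ σ hσ hQ => ?_)
  · set f' : Site → Prop := fun x => ∃ h : Λ.mem x, f ⟨x, h⟩ with hf'
    have hiff : ∀ w : VSite Λ, f' w ↔ f w := fun w => ⟨fun h => h.2, fun h => ⟨w.2, h⟩⟩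
    have hedge : ∀ x i, EdgeMem Q x i → (f' x ↔ f' (x + unit i)) := by
      intro x i h
      obtain ⟨h1, h2, h⟩ := h.exists_edgeInComplex
      exact (hiff ⟨x, h1⟩).trans ((hf _ _ h).trans (hiff ⟨_, h2⟩).symm)
    have hbase : ∀ w, vertexInComplex Q w → ∃ x i j, PlaqMem Q x i j ∧ (f' x ↔ f w) := by
      rintro w ⟨p, hp, hw⟩
      have h0 : PlaqMem Q p.1.1 p.1.2.1 p.1.2.2 := ⟨p, hp, Or.inl rfl⟩
      refine ⟨_, _, _, h0, ?_⟩
      rw [← hiff w]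
      rcases hw with rfl | rfl | rfl | rfl
      · rfl
      · exact hedge _ _ h0.edgeMem
      · exact (hedge _ _ h0.edgeMem).trans (hedge _ _ h0.symm.edgeMem_add)
      · exact hedge _ _ h0.symm.edgeMem
    obtain ⟨x, i, j, hx, hxu⟩ := hbase u hu
    obtain ⟨y, k, l, hy, hyv⟩ := hbase v hv
    exact hyv.mp (hconn f' hedge x i j y k l hx hy (hxu.mpr hfu))
  · set τ : Site → Site → H := fun x y =>
      if h : Λ.mem x ∧ Λ.mem y then σ ⟨x, h.1⟩ ⟨y, h.2⟩ else 1 with hτ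
    have hτσ : ∀ u v : VSite Λ, τ u v = σ u v := fun u v => dif_pos ⟨u.2, v.2⟩
    obtain ⟨g, hg⟩ := hgauge H (fun x i => τ x (x + unit i)) (by
      rintro x i j ⟨p, hp, h⟩
      have key : FlatAt (fun x i => τ x (x + unit i)) p.1.1 p.1.2.1 p.1.2.2 := by
        have h1 := hQ p hp
        have h2 := hτσ p.c0 p.c1
        have h3 := hτσ p.c1 p.c2
        have h4 := hτσ p.c0 p.c3
        have h5 := hτσ p.c3 p.c2
        simp only [FlatAt]
        rw [add_right_comm p.1.1 (unit p.1.2.2)]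
        rw [Plaq.c0, Plaq.c1] at h2
        rw [Plaq.c1, Plaq.c2] at h3
        rw [Plaq.c0, Plaq.c3] at h4
        rw [Plaq.c3, Plaq.c2] at h5
        rw [h2, h3, h4, h5]
        rw [eq_inv_of_mul_eq_one_left (hσ p.c2 p.c3), eq_inv_of_mul_eq_one_left (hσ p.c3 p.c0),
          mul_inv_eq_one, mul_inv_eq_iff_eq_mul] at h1
        exact h1
      rcases h with h | h <;> rw [h] at key
      exacts [key, key.symm])
    refine ⟨fun u => g u, fun u v huv => ?_⟩
    obtain ⟨p, hp, h | h⟩ := huv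
    · obtain ⟨i, hv, he⟩ := exists_edgeMem_of_mem_plaqEdges hp h
      have := hg _ _ he
      rwa [← hv, hτσ] at this
    · obtain ⟨i, hv, he⟩ := exists_edgeMem_of_mem_plaqEdges hp h
      have := hg _ _ he
      rw [← hv, hτσ] at this
      show σ u v * g v = g u
      rw [← this, ← mul_assoc, hσ, one_mul]

lemma exists_plaq_of_lt {x : Site} {i j : Fin 4} (hij : i < j) (hx : Λ.mem x)
    (hy : Λ.mem (x + unit i + unit j)) : ∃ p : Plaq Λ, p.1 = (x, i, j) := by
  refine ⟨⟨(x, i, j), hij, hx, fun l => ?_, hy, fun l => ?_⟩, rfl⟩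
  all_goals
    have h1 := hx l
    have h2 := hy l
    have h3 := unit_apply_nonneg i l
    have h4 := unit_apply_nonneg j l
    simp only [Pi.add_apply] at h2 ⊢
    omega

lemma exists_plaq {x : Site} {i j : Fin 4} (hij : i ≠ j) (hx : Λ.mem x)
    (hy : Λ.mem (x + unit i + unit j)) : ∃ p : Plaq Λ, p.1 = (x, i, j) ∨ p.1 = (x, j, i) := by
  rcases lt_or_gt_of_ne hij with h | h
  · obtain ⟨p, hp⟩ := exists_plaq_of_lt h hx hy
    exact ⟨p, Or.inl hp⟩
  · obtain ⟨p, hp⟩ := exists_plaq_of_lt h hx (by rwa [add_right_comm])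
    exact ⟨p, Or.inr hp⟩

lemma Rect.plaqIn_iff (B : Rect Λ) {p : Plaq Λ} {x : Site} {i j : Fin 4}
    (h : p.1 = (x, i, j) ∨ p.1 = (x, j, i)) :
    B.plaqIn p ↔ x ∈ siteBox B.lo B.hi ∧ x + unit i + unit j ∈ siteBox B.lo B.hi := by
  have key : B.plaqIn p ↔ p.1.1 ∈ siteBox B.lo B.hi ∧
      p.1.1 + unit p.1.2.1 + unit p.1.2.2 ∈ siteBox B.lo B.hi := by
    refine ⟨fun h => ⟨h.1, h.2.2.1⟩, fun h => ⟨h.1, fun l => ?_, h.2, fun l => ?_⟩⟩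
    all_goals
      have h1 := h.1 l
      have h2 := h.2 l
      have h3 := unit_apply_nonneg p.1.2.1 l
      have h4 := unit_apply_nonneg p.1.2.2 l
      simp only [Plaq.c1, Plaq.c3, Pi.add_apply] at h2 ⊢
      omega
  rcases h with h | h <;> rw [key, h]
  rw [add_right_comm]

lemma PlaqMem.mem_box {x : Site} {i j : Fin 4} (h : PlaqMem Q x i j) :
    i ≠ j ∧ Λ.mem x ∧ Λ.mem (x + unit i + unit j) := by
  obtain ⟨⟨⟨y, k, l⟩, hkl, h0, h1, h2, h3⟩, hp, h | h⟩ := h <;>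
  · simp only [Prod.mk.injEq] at h
    obtain ⟨rfl, rfl, rfl⟩ := h
    first
      | exact ⟨hkl.ne, h0, h2⟩
      | exact ⟨hkl.ne', h0, by rwa [add_right_comm]⟩

lemma plaqMem_S2 {B : Rect Λ} {x : Site} {i j : Fin 4} :
    PlaqMem (S2 B) x i j ↔
      i ≠ j ∧ x ∈ siteBox B.lo B.hi ∧ x + unit i + unit j ∈ siteBox B.lo B.hi := by
  constructor
  · intro h
    have hij := h.mem_box.1
    obtain ⟨p, hp, h⟩ := h
    exact ⟨hij, (B.plaqIn_iff h).mp hp⟩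
  · rintro ⟨hij, h⟩
    have hB : ∀ y ∈ siteBox B.lo B.hi, Λ.mem y := fun y hy l =>
      ⟨(B.a_le_lo l).trans (hy l).1, (hy l).2.trans (B.hi_le_b l)⟩
    obtain ⟨p, hp⟩ := exists_plaq hij (hB _ h.1) (hB _ h.2)
    exact ⟨p, (B.plaqIn_iff hp).mpr h, hp⟩

lemma plaqMem_bS2 {B : Rect Λ} {x : Site} {i j : Fin 4} :
    PlaqMem (bS2 B) x i j ↔ PlaqMem (S2 B) x i j ∧
      (∃ k, k ≠ i ∧ k ≠ j ∧ (x k = B.lo k ∨ x k = B.hi k)) ∧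
      ∀ k, k ≠ i → k ≠ j → x k ≠ Λ.a k ∧ x k ≠ Λ.b k := by
  have key : ∀ p : Plaq Λ, (p.1 = (x, i, j) ∨ p.1 = (x, j, i)) → (p ∈ bS2 B ↔ p ∈ S2 B ∧
      (∃ k, k ≠ i ∧ k ≠ j ∧ (x k = B.lo k ∨ x k = B.hi k)) ∧
      ∀ k, k ≠ i → k ≠ j → x k ≠ Λ.a k ∧ x k ≠ Λ.b k) := by
    intro p hp
    simp only [bS2, Plaq.onRectBoundary, Plaq.onBoxBoundary, Set.mem_ofPred_eq, S2, Rect.plaqSet,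
      not_exists, not_and, not_or, ne_eq, and_assoc]
    rcases hp with h | h <;> rw [h]
    simp only [← ne_eq, and_left_comm (a := _ ≠ j) (b := _ ≠ i)]
    refine and_congr_right fun _ => and_congr_right fun _ => ?_
    exact forall_congr' fun k => ⟨fun h a b => h b a, fun h a b => h b a⟩
  constructor
  · rintro ⟨p, hp, h⟩
    have := (key p h).mp hp
    exact ⟨⟨p, this.1, h⟩, this.2⟩
  · rintro ⟨⟨p, hp, h⟩, h'⟩
    exact ⟨p, (key p h).mpr ⟨hp, h'⟩, h⟩

lemma plaqMem_S2c {B : Rect Λ} {x : Site} {i j : Fin 4} :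
    PlaqMem (S2c B) x i j ↔
      (i ≠ j ∧ Λ.mem x ∧ Λ.mem (x + unit i + unit j) ∧
        ¬ (x ∈ siteBox B.lo B.hi ∧ x + unit i + unit j ∈ siteBox B.lo B.hi)) ∨
      PlaqMem (bS2 B) x i j := by
  constructor
  · intro h
    have hij := h.mem_box
    obtain ⟨p, hp | hp, h⟩ := h
    · exact Or.inl ⟨hij.1, hij.2.1, hij.2.2, fun hB => hp ((B.plaqIn_iff h).mpr hB)⟩
    · exact Or.inr ⟨p, hp, h⟩
  · rintro (⟨hij, h1, h2, h3⟩ | ⟨p, hp, h⟩)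
    · obtain ⟨p, hp⟩ := exists_plaq hij h1 h2
      exact ⟨p, Or.inl fun h => h3 ((B.plaqIn_iff hp).mp h), hp⟩
    · exact ⟨p, Or.inr hp, h⟩

end Planes

section SiteBox

variable {lo hi x y : Site} {i j : Fin 4}

lemma add_unit_mem_siteBox (hx : x ∈ siteBox lo hi) : x + unit i ∈ siteBox lo hi ↔ x i < hi i := by
  refine ⟨fun h => ?_, fun h l => ?_⟩
  · have := (h i).2
    rw [Pi.add_apply, unit_apply_self] at this
    omega
  · have := hx l
    rw [Pi.add_apply, unit_apply]
    split_ifs with hl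
    · subst hl; omega
    · omega

lemma add_unit_add_unit_mem_siteBox (hij : i ≠ j) (hx : x ∈ siteBox lo hi) :
    x + unit i + unit j ∈ siteBox lo hi ↔ x i < hi i ∧ x j < hi j := by
  constructor
  · intro h
    have h1 := (h i).2
    have h2 := (h j).2
    rw [Pi.add_apply, Pi.add_apply, unit_apply_self, unit_apply_of_ne hij] at h1
    rw [Pi.add_apply, Pi.add_apply, unit_apply_self, unit_apply_of_ne hij.symm] at h2
    omega
  · rintro ⟨h1, h2⟩
    rw [add_unit_mem_siteBox ((add_unit_mem_siteBox hx).mpr h1), Pi.add_apply,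
      unit_apply_of_ne hij.symm, add_zero]
    exact h2

lemma mem_siteBox_of_add_unit (h : y ∈ siteBox lo hi) (h' : y + unit i + unit j ∈ siteBox lo hi) :
    y + unit i ∈ siteBox lo hi ∧ y + unit j ∈ siteBox lo hi := by
  refine ⟨fun l => ?_, fun l => ?_⟩
  all_goals
    have h1 := h l
    have h2 := h' l
    have h3 := unit_apply_nonneg i l
    have h4 := unit_apply_nonneg j l
    simp only [Pi.add_apply] at h2 ⊢
    omega

lemma siteBox_inter (lo hi lo' hi' : Site) :
    siteBox lo hi ∩ siteBox lo' hi' = siteBox (lo ⊔ lo') (hi ⊓ hi') := by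
  ext x
  simp only [siteBox, Set.mem_inter_iff, Set.mem_ofPred_eq, Pi.sup_apply, Pi.inf_apply, sup_le_iff,
    le_inf_iff]
  exact ⟨fun h l => ⟨⟨(h.1 l).1, (h.2 l).1⟩, (h.1 l).2, (h.2 l).2⟩,
    fun h => ⟨fun l => ⟨(h l).1.1, (h l).2.1⟩, fun l => ⟨(h l).1.2, (h l).2.2⟩⟩⟩

/-- The part of a box of sites where the coordinate `k` is restricted to an interval. -/
def slab (lo hi : Site) (k : Fin 4) (u v : ℤ) : Set Site :=
  siteBox (Function.update lo k u) (Function.update hi k v)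

lemma mem_slab {k : Fin 4} {u v : ℤ} :
    x ∈ slab lo hi k u v ↔ (u ≤ x k ∧ x k ≤ v) ∧ ∀ l, l ≠ k → lo l ≤ x l ∧ x l ≤ hi l := by
  constructor
  · intro h
    refine ⟨by simpa using h k, fun l hl => ?_⟩
    have := h l
    rwa [Function.update_of_ne hl, Function.update_of_ne hl] at this
  · rintro ⟨h1, h2⟩ l
    by_cases hl : l = k
    · subst hl
      simpa using h1
    · rw [Function.update_of_ne hl, Function.update_of_ne hl]
      exact h2 l hl

lemma mem_slab_iff_of_le {k : Fin 4} {u v : ℤ} (hu : lo k ≤ u) (hv : v ≤ hi k) :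
    x ∈ slab lo hi k u v ↔ x ∈ siteBox lo hi ∧ u ≤ x k ∧ x k ≤ v := by
  rw [mem_slab]
  constructor
  · rintro ⟨h1, h2⟩
    refine ⟨fun l => ?_, h1⟩
    by_cases hl : l = k
    · subst hl; omega
    · exact h2 l hl
  · exact fun h => ⟨h.2, fun l _ => h.1 l⟩

/-- Slabs along the facets of a box form a cube-like cover. -/
lemma cubeCover_slab {I : Set (Fin 4 × Bool)} {u v : Fin 4 × Bool → ℤ}
    (hdir : ∀ k, ∃ b, (k, b) ∈ I) (hle : lo ≤ hi)
    (huv : ∀ α ∈ I, u α ≤ v α) (hlo : ∀ α ∈ I, lo α.1 ≤ u α) (hhi : ∀ α ∈ I, v α ≤ hi α.1)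
    (hdisj : ∀ k, (k, false) ∈ I → (k, true) ∈ I → v (k, false) < u (k, true)) :
    CubeCover I (fun α => slab lo hi α.1 (u α) (v α)) where
  dir := hdir
  conn α _ β _ := by
    simp only [slab, siteBox_inter]
    exact edgeConn_siteBox _ _
  inter α hα β hβ γ hγ h1 h2 h3 := by
    set x : Site := fun l => if l = α.1 then u α else if l = β.1 then u β else
      if l = γ.1 then u γ else lo l with hx
    have hxα : x α.1 = u α := by simp [hx]
    have hxβ : x β.1 = u β := by simp [hx, h1.symm]
    have hxγ : x γ.1 = u γ := by simp [hx, h2.symm, h3.symm]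
    have hbox : x ∈ siteBox lo hi := by
      intro l
      simp only [hx]
      split_ifs with e1 e2 e3
      · subst e1; exact ⟨hlo α hα, (huv α hα).trans (hhi α hα)⟩
      · subst e2; exact ⟨hlo β hβ, (huv β hβ).trans (hhi β hβ)⟩
      · subst e3; exact ⟨hlo γ hγ, (huv γ hγ).trans (hhi γ hγ)⟩
      · exact ⟨le_rfl, hle l⟩
    have hmem : ∀ δ ∈ I, x δ.1 = u δ → x ∈ slab lo hi δ.1 (u δ) (v δ) := fun δ hδ h =>
      (mem_slab_iff_of_le (hlo δ hδ) (hhi δ hδ)).mpr ⟨hbox, h.ge, h.trans_le (huv δ hδ)⟩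
    exact ⟨x, ⟨hmem α hα hxα, hmem β hβ hxβ⟩, hmem γ hγ hxγ⟩
  disj α hα β hβ h1 h2 := by
    rw [Set.disjoint_left]
    intro x hx hy
    obtain ⟨k, b⟩ := α
    obtain ⟨l, c⟩ := β
    obtain rfl : k = l := h1
    have hx := (mem_slab.mp hx).1
    have hy := (mem_slab.mp hy).1
    simp only at hx hy
    cases b <;> cases c
    · exact h2 rfl
    · have := hdisj k hα hβ; omega
    · have := hdisj k hβ hα; omega
    · exact h2 rfl

end SiteBox

section GoodRectangles

variable {Λ : Box} {Q : Set (Plaq Λ)} {B : Rect Λ}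

lemma edgeMem_of_siteBox {lo hi x : Site} {i j : Fin 4} (hij : i ≠ j) (hj : lo j < hi j)
    (hQ : ∀ y, y ∈ siteBox lo hi → y + unit i + unit j ∈ siteBox lo hi → PlaqMem Q y i j)
    (hx : x ∈ siteBox lo hi) (hxi : x + unit i ∈ siteBox lo hi) : EdgeMem Q x i := by
  rw [add_unit_mem_siteBox hx] at hxi
  rcases lt_or_ge (x j) (hi j) with h | h
  · exact ⟨j, Or.inl (hQ x hx ((add_unit_add_unit_mem_siteBox hij hx).mpr ⟨hxi, h⟩))⟩
  · obtain ⟨y, rfl⟩ : ∃ y, x = y + unit j := ⟨x - unit j, (sub_add_cancel _ _).symm⟩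
    have hyi : (y + unit j) i = y i := by rw [Pi.add_apply, unit_apply_of_ne hij, add_zero]
    have hyj : (y + unit j) j = y j + 1 := by rw [Pi.add_apply, unit_apply_self]
    have hy : y ∈ siteBox lo hi := by
      intro l
      by_cases hl : l = j
      · subst hl; have := hx l; omega
      · have := hx l
        rwa [Pi.add_apply, unit_apply_of_ne hl, add_zero] at this
    have := (hx j).2
    refine ⟨j, Or.inr ⟨y, rfl, hQ y hy ((add_unit_add_unit_mem_siteBox hij hy).mpr ⟨?_, ?_⟩)⟩⟩ <;>
      omega

lemma EdgeMem.exists_siteBox {ι : Type*} {I : Set ι} {lo hi : ι → Site}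
    (hQ : ∀ y i j, PlaqMem Q y i j → ∃ α ∈ I, y ∈ siteBox (lo α) (hi α) ∧
      y + unit i + unit j ∈ siteBox (lo α) (hi α)) {x : Site} {i : Fin 4} (h : EdgeMem Q x i) :
    ∃ α ∈ I, x ∈ siteBox (lo α) (hi α) ∧ x + unit i ∈ siteBox (lo α) (hi α) := by
  obtain ⟨j, h | ⟨y, rfl, h⟩⟩ := h
  · obtain ⟨α, hα, h1, h2⟩ := hQ _ _ _ h
    exact ⟨α, hα, h1, (mem_siteBox_of_add_unit h1 h2).1⟩
  · obtain ⟨α, hα, h1, h2⟩ := hQ _ _ _ h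
    exact ⟨α, hα, (mem_siteBox_of_add_unit h1 h2).2, by rwa [add_right_comm]⟩

lemma simplyConnectedC_S2 (hB : ∀ k, B.lo k < B.hi k) : SimplyConnectedC (S2 B) := by
  have hplaq : ∀ x i j, i ≠ j → x ∈ siteBox B.lo B.hi →
      x + unit i + unit j ∈ siteBox B.lo B.hi → PlaqMem (S2 B) x i j :=
    fun x i j hij hx hy => plaqMem_S2.mpr ⟨hij, hx, hy⟩
  refine simplyConnectedC_of_flat (fun f hf x i j y k l hx hy => ?_) (fun H _ s hs => ?_)
  · refine edgeConn_siteBox B.lo B.hi f (fun z m hz hzm => hf z m ?_) x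
      (plaqMem_S2.mp hx).2.1 y (plaqMem_S2.mp hy).2.1
    obtain ⟨n, hn⟩ := exists_ne m
    exact edgeMem_of_siteBox hn.symm (hB n) (fun w => hplaq w m n hn.symm) hz hzm
  · obtain ⟨g, hg⟩ := exists_trivialOn_siteBox (s := s) (c := B.lo) (lo := B.lo) (hi := B.hi)
      (fun l => ⟨le_rfl, B.lo_le_hi l⟩) 0
      (fun x i hi hx hy => hs _ _ _ (hplaq _ _ _ hi hx hy))
      (fun x i k hik _ _ _ hx hy => hs _ _ _ (hplaq _ _ _ hik hx hy))
    refine ⟨g, fun x i hxi => ?_⟩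
    obtain ⟨-, -, h1, h2⟩ := hxi.exists_siteBox (I := {()}) (lo := fun _ => B.lo)
      (hi := fun _ => B.hi) (fun y i j h => ⟨(), rfl, (plaqMem_S2.mp h).2⟩)
    exact hg x i h1 h2

/-- The facets of `B` not contained in the boundary of `Λ`; the facet in direction `k` is the upper
one for `(k, true)` and the lower one for `(k, false)`. -/
def freeFacets (B : Rect Λ) : Set (Fin 4 × Bool) :=
  {α | if α.2 then B.hi α.1 < Λ.b α.1 else Λ.a α.1 < B.lo α.1}

lemma mem_freeFacets_true {k : Fin 4} : (k, true) ∈ freeFacets B ↔ B.hi k < Λ.b k := by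
  simp [freeFacets]

lemma mem_freeFacets_false {k : Fin 4} : (k, false) ∈ freeFacets B ↔ Λ.a k < B.lo k := by
  simp [freeFacets]

lemma exists_mem_freeFacets (hfull : ∀ k, Λ.a k < B.lo k ∨ B.hi k < Λ.b k) (k : Fin 4) :
    ∃ b, (k, b) ∈ freeFacets B := by
  rcases hfull k with h | h
  exacts [⟨false, mem_freeFacets_false.mpr h⟩, ⟨true, mem_freeFacets_true.mpr h⟩]

/-- The position of a facet of `B`. -/
def facetPos (B : Rect Λ) (α : Fin 4 × Bool) : ℤ := if α.2 then B.hi α.1 else B.lo α.1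

/-- The part of `Λ` beyond a facet of `B`. -/
def beyond (B : Rect Λ) (α : Fin 4 × Bool) : Set Site :=
  slab Λ.a Λ.b α.1 (if α.2 then B.hi α.1 else Λ.a α.1) (if α.2 then Λ.b α.1 else B.lo α.1)

lemma mem_beyond_true {x : Site} {k : Fin 4} :
    x ∈ beyond B (k, true) ↔ Λ.mem x ∧ B.hi k ≤ x k := by
  rw [beyond, if_pos rfl, if_pos rfl,
    mem_slab_iff_of_le ((B.a_le_lo k).trans (B.lo_le_hi k)) le_rfl]
  exact and_congr_right fun hx => and_iff_left (hx k).2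

lemma mem_beyond_false {x : Site} {k : Fin 4} :
    x ∈ beyond B (k, false) ↔ Λ.mem x ∧ x k ≤ B.lo k := by
  rw [beyond, if_neg Bool.false_ne_true, if_neg Bool.false_ne_true,
    mem_slab_iff_of_le le_rfl ((B.lo_le_hi k).trans (B.hi_le_b k))]
  exact and_congr_right fun hx => and_iff_right (hx k).1

lemma mem_of_mem_beyond {x : Site} {α : Fin 4 × Bool} (h : x ∈ beyond B α) : Λ.mem x := by
  obtain ⟨k, b | b⟩ := α
  exacts [(mem_beyond_false.mp h).1, (mem_beyond_true.mp h).1]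

lemma cubeCover_beyond (hB : ∀ k, B.lo k < B.hi k)
    (hfull : ∀ k, Λ.a k < B.lo k ∨ B.hi k < Λ.b k) : CubeCover (freeFacets B) (beyond B) := by
  have h : ∀ k, Λ.a k ≤ B.lo k ∧ B.lo k ≤ B.hi k ∧ B.hi k ≤ Λ.b k :=
    fun k => ⟨B.a_le_lo k, B.lo_le_hi k, B.hi_le_b k⟩
  refine cubeCover_slab (exists_mem_freeFacets hfull)
    (fun k => (h k).1.trans ((h k).2.1.trans (h k).2.2)) ?_ ?_ ?_ (fun k _ _ => ?_)
  · rintro ⟨k, b | b⟩ - <;> simp [h k]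
  · rintro ⟨k, b | b⟩ - <;> simp [(h k).1.trans (h k).2.1]
  · rintro ⟨k, b | b⟩ - <;> simp [(h k).2.1.trans (h k).2.2]
  · simpa using hB k

lemma PlaqMem.exists_facet {x : Site} {i j : Fin 4} (h : PlaqMem (bS2 B) x i j) :
    ∃ α ∈ freeFacets B, i ≠ α.1 ∧ j ≠ α.1 ∧ x α.1 = facetPos B α := by
  obtain ⟨h1, ⟨k, hki, hkj, hk⟩, h2⟩ := plaqMem_bS2.mp h
  have h3 := h2 k hki hkj
  have h4 := (plaqMem_S2.mp h1).2.1 k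
  have h5 := B.a_le_lo k
  have h6 := B.hi_le_b k
  rcases hk with hk | hk
  · refine ⟨(k, false), mem_freeFacets_false.mpr ?_, hki.symm, hkj.symm,
      by simpa [facetPos] using hk⟩
    omega
  · refine ⟨(k, true), mem_freeFacets_true.mpr ?_, hki.symm, hkj.symm,
      by simpa [facetPos] using hk⟩
    omega

lemma PlaqMem.exists_beyond {x : Site} {i j : Fin 4} (h : PlaqMem (S2c B) x i j) :
    ∃ α ∈ freeFacets B, x ∈ beyond B α ∧ x + unit i + unit j ∈ beyond B α := by
  obtain ⟨hij, hx, hy⟩ := h.mem_box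
  have hadd : ∀ l, (x + unit i + unit j) l = x l ∨ (x + unit i + unit j) l = x l + 1 := by
    intro l
    simp only [Pi.add_apply, unit_apply]
    split_ifs with e1 e2
    · exact absurd (e1.symm.trans e2) hij
    all_goals simp
  rcases plaqMem_S2c.mp h with ⟨-, -, -, hxy⟩ | h
  · obtain ⟨l, hl⟩ : ∃ l, x l < B.lo l ∨ B.hi l < (x + unit i + unit j) l := by
      by_contra! hall
      refine hxy ⟨fun l => ?_, fun l => ?_⟩ <;>
      · have := hadd l
        have := hall l
        omega
    have h1 := hadd l
    have h2 := hx l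
    have h3 := hy l
    rcases hl with hl | hl
    · refine ⟨(l, false), mem_freeFacets_false.mpr ?_, mem_beyond_false.mpr ⟨hx, ?_⟩,
        mem_beyond_false.mpr ⟨hy, ?_⟩⟩ <;> omega
    · refine ⟨(l, true), mem_freeFacets_true.mpr ?_, mem_beyond_true.mpr ⟨hx, ?_⟩,
        mem_beyond_true.mpr ⟨hy, ?_⟩⟩ <;> omega
  · obtain ⟨⟨k, b⟩, hα, hi, hj, hk⟩ := h.exists_facet
    have : (x + unit i + unit j) k = x k := by
      simp only [Pi.add_apply, unit_apply_of_ne hi.symm, unit_apply_of_ne hj.symm, add_zero]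
    cases b
    · simp only [facetPos, Bool.false_eq_true, if_false] at hk
      exact ⟨_, hα, mem_beyond_false.mpr ⟨hx, hk.le⟩, mem_beyond_false.mpr ⟨hy, (this.trans hk).le⟩⟩
    · simp only [facetPos, if_true] at hk
      exact ⟨_, hα, mem_beyond_true.mpr ⟨hx, hk.ge⟩, mem_beyond_true.mpr ⟨hy, (this.trans hk).ge⟩⟩

lemma simplyConnectedC_S2c (hB : ∀ k, B.lo k < B.hi k)
    (hfull : ∀ k, Λ.a k < B.lo k ∨ B.hi k < Λ.b k) : SimplyConnectedC (S2c B) := by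
  have hcover := cubeCover_beyond hB hfull
  have hplaq : ∀ α ∈ freeFacets B, ∀ x i, i ≠ α.1 → x ∈ beyond B α →
      x + unit i + unit α.1 ∈ beyond B α → PlaqMem (S2c B) x i α.1 := by
    rintro ⟨k, b⟩ hα x i hi hx hy
    refine plaqMem_S2c.mpr (Or.inl ⟨hi, mem_of_mem_beyond hx, mem_of_mem_beyond hy, fun h => ?_⟩)
    have h1 := h.1 k
    have h2 : (x + unit i + unit k) k ≤ B.hi k := (h.2 k).2
    have h3 : (x + unit i + unit k) k = x k + 1 := by
      simp only [Pi.add_apply, unit_apply_of_ne hi.symm, unit_apply_self, add_zero]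
    cases b
    · have : (x + unit i + unit k) k ≤ B.lo k := (mem_beyond_false.mp hy).2
      omega
    · have : B.hi k ≤ x k := (mem_beyond_true.mp hx).2
      omega
  have hedge : ∀ α ∈ freeFacets B, ∀ x i, x ∈ beyond B α → x + unit i ∈ beyond B α →
      EdgeMem (S2c B) x i := by
    rintro α hα x i hx hxi
    rcases eq_or_ne i α.1 with hi | hi
    · obtain ⟨j, hj⟩ := exists_ne i
      refine edgeMem_of_siteBox hj.symm ?_ (fun y hy hyi => ?_) hx hxi
      · rw [Function.update_of_ne (hi ▸ hj), Function.update_of_ne (hi ▸ hj)]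
        exact (B.a_le_lo j).trans_lt ((hB j).trans_le (B.hi_le_b j))
      · rw [add_right_comm] at hyi
        subst hi
        exact (hplaq α hα y j hj hy hyi).symm
    · refine edgeMem_of_siteBox hi ?_ (fun y => hplaq α hα y i hi) hx hxi
      obtain ⟨k, b⟩ := α
      have := hB k
      have := B.a_le_lo k
      have := B.hi_le_b k
      cases b <;> simp [freeFacets] at hα ⊢ <;> omega
  refine simplyConnectedC_of_flat (fun f hf x i j y k l hx hy => ?_) (fun H _ s hs => ?_)
  · obtain ⟨α, hα, hxα, -⟩ := hx.exists_beyond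
    obtain ⟨β, hβ, hyβ, -⟩ := hy.exists_beyond
    exact hcover.forall_imp (fun γ hγ z m hz hzm => hf z m (hedge γ hγ z m hz hzm))
      α hα β hβ x hxα y hyβ
  · obtain ⟨g, hg⟩ := hcover.exists_trivialOn (s := s) (fun α hα => by
      set e : ℤ := if α.2 then Λ.b α.1 else Λ.a α.1 with he
      have hab : ∀ k, Λ.a k ≤ Λ.b k :=
        fun k => (B.a_le_lo k).trans ((B.lo_le_hi k).trans (B.hi_le_b k))
      refine exists_trivialOn_siteBox (c := Function.update Λ.a α.1 e) ?_ α.1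
        (fun x i hi hx hy => hs _ _ _ (hplaq α hα x i hi hx hy)) ?_
      · refine mem_slab.mpr ⟨?_, fun l hl => ?_⟩
        · obtain ⟨k, b⟩ := α
          have := B.a_le_lo k
          have := B.lo_le_hi k
          have := B.hi_le_b k
          cases b <;> simp [he] <;> omega
        · rw [Function.update_of_ne hl]
          exact ⟨le_rfl, hab l⟩
      · intro x i k hik hi hk hxe hx hy
        rw [Function.update_self] at hxe
        refine hs _ _ _ (plaqMem_S2c.mpr (Or.inl ⟨hik, mem_of_mem_beyond hx, mem_of_mem_beyond hy,
          fun h => ?_⟩))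
        have h1 := h.1 α.1
        obtain ⟨l, b⟩ := α
        cases b <;> simp [freeFacets, he] at hα hxe h1 <;> omega)
    refine ⟨g, fun x i hxi => ?_⟩
    obtain ⟨α, hα, h1, h2⟩ := hxi.exists_siteBox fun y i j h => h.exists_beyond
    exact hg α hα x i h1 h2

end GoodRectangles

section Boundary

variable {Λ : Box} {B : Rect Λ}

/-- The lower corner of the box of sites of `B` not on the boundary of `Λ`. -/
def innerLo (B : Rect Λ) : Site := fun k => max (B.lo k) (Λ.a k + 1)

/-- The upper corner of the box of sites of `B` not on the boundary of `Λ`. -/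
def innerHi (B : Rect Λ) : Site := fun k => min (B.hi k) (Λ.b k - 1)

/-- The part of a facet of `B` not on the boundary of `Λ`. -/
def innerFacet (B : Rect Λ) (α : Fin 4 × Bool) : Set Site :=
  slab (innerLo B) (innerHi B) α.1 (facetPos B α) (facetPos B α)

/-- The site `x` is not on the boundary of `Λ` in direction `k`. -/
def Inner (Λ : Box) (x : Site) (k : Fin 4) : Prop := Λ.a k < x k ∧ x k < Λ.b k

lemma mem_innerFacet {x : Site} {α : Fin 4 × Bool} (hα : α ∈ freeFacets B)
    (hB : ∀ k, B.lo k < B.hi k) :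
    x ∈ innerFacet B α ↔ x ∈ siteBox B.lo B.hi ∧ (∀ k, Inner Λ x k) ∧ x α.1 = facetPos B α := by
  rw [innerFacet, mem_slab]
  simp only [innerLo, innerHi, max_le_iff, le_min_iff, Inner]
  obtain ⟨k, b⟩ := α
  have h1 := B.a_le_lo k
  have h2 := B.hi_le_b k
  have h3 := hB k
  have h4 : Λ.a k < facetPos B (k, b) ∧ facetPos B (k, b) < Λ.b k ∧
      B.lo k ≤ facetPos B (k, b) ∧ facetPos B (k, b) ≤ B.hi k := by
    cases b
    · have := mem_freeFacets_false.mp hα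
      simp only [facetPos, Bool.false_eq_true, if_false]
      omega
    · have := mem_freeFacets_true.mp hα
      simp only [facetPos, if_true]
      omega
  constructor
  · rintro ⟨hk, hl⟩
    have hk' : x k = facetPos B (k, b) := le_antisymm hk.2 hk.1
    refine ⟨fun l => ?_, fun l => ?_, hk'⟩
    all_goals
      by_cases hlk : l = k
      · subst hlk; omega
      · have := hl l hlk; omega
  · rintro ⟨hx, hin, hk⟩
    refine ⟨⟨hk.ge, hk.le⟩, fun l _ => ?_⟩
    have := hx l
    have := hin l
    omega

lemma cubeCover_innerFacet (hB : ∀ k, B.lo k < B.hi k)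
    (hfull : ∀ k, Λ.a k < B.lo k ∨ B.hi k < Λ.b k) : CubeCover (freeFacets B) (innerFacet B) := by
  have h : ∀ k, Λ.a k ≤ B.lo k ∧ B.hi k ≤ Λ.b k := fun k => ⟨B.a_le_lo k, B.hi_le_b k⟩
  refine cubeCover_slab (exists_mem_freeFacets hfull) (fun k => ?_) (fun _ _ => le_rfl) ?_ ?_
    (fun k _ _ => by simpa [facetPos] using hB k)
  · have := h k
    have := hB k
    have := hfull k
    show innerLo B k ≤ innerHi B k
    simp only [innerLo, innerHi, max_le_iff, le_min_iff]
    omega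
  · rintro ⟨k, b | b⟩ hα
    · have := mem_freeFacets_false.mp hα
      simp only [facetPos, Bool.false_eq_true, if_false]
      exact max_le le_rfl (by omega)
    · have := h k
      have := hB k
      simp only [facetPos, if_true]
      exact max_le (by omega) (by omega)
  · rintro ⟨k, b | b⟩ hα
    · have := h k
      have := hB k
      simp only [facetPos, Bool.false_eq_true, if_false]
      exact le_min (by omega) (by omega)
    · have := mem_freeFacets_true.mp hα
      simp only [facetPos, if_true]
      exact le_min le_rfl (by omega)

lemma plaqMem_bS2_of_facet {α : Fin 4 × Bool} {x : Site} {i j : Fin 4} (hij : i ≠ j)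
    (hi : i ≠ α.1) (hj : j ≠ α.1) (hx : x ∈ siteBox B.lo B.hi)
    (hy : x + unit i + unit j ∈ siteBox B.lo B.hi) (hxα : x α.1 = facetPos B α)
    (hin : ∀ k, k ≠ i → k ≠ j → Inner Λ x k) : PlaqMem (bS2 B) x i j := by
  refine plaqMem_bS2.mpr ⟨plaqMem_S2.mpr ⟨hij, hx, hy⟩, ⟨α.1, hi.symm, hj.symm, ?_⟩,
    fun k hki hkj => ⟨(hin k hki hkj).1.ne', (hin k hki hkj).2.ne⟩⟩
  rw [hxα, facetPos]
  split_ifs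
  exacts [Or.inr rfl, Or.inl rfl]

lemma edgeMem_bS2_of_innerFacet (hB : ∀ k, B.lo k < B.hi k) {α : Fin 4 × Bool}
    (hα : α ∈ freeFacets B) {x : Site} {i : Fin 4} (hx : x ∈ innerFacet B α)
    (hxi : x + unit i ∈ innerFacet B α) : EdgeMem (bS2 B) x i := by
  rw [mem_innerFacet hα hB] at hx hxi
  have hi : i ≠ α.1 := by
    rintro rfl
    have := hxi.2.2
    rw [Pi.add_apply, unit_apply_self] at this
    have := hx.2.2
    omega
  obtain ⟨j, hji, hj⟩ : ∃ j : Fin 4, j ≠ i ∧ j ≠ α.1 := by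
    generalize α.1 = k
    clear hi hx hxi
    revert i k
    decide
  have hxx : ∀ l, x l ≤ (x + unit i) l := fun l => by
    have := unit_apply_nonneg i l
    rw [Pi.add_apply]
    omega
  refine edgeMem_of_siteBox (lo := fun l => if l = j then B.lo l else x l)
    (hi := fun l => if l = j then B.hi l else (x + unit i) l) hji.symm
    (by simpa using hB j) ?_ ?_ ?_
  · have hbox : ∀ y ∈ siteBox (fun l => if l = j then B.lo l else x l)
        (fun l => if l = j then B.hi l else (x + unit i) l),
        y ∈ siteBox B.lo B.hi ∧ ∀ l, l ≠ j → x l ≤ y l ∧ y l ≤ (x + unit i) l := by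
      intro y hy
      have hyl : ∀ l, l ≠ j → x l ≤ y l ∧ y l ≤ (x + unit i) l := fun l hl => by
        simpa only [if_neg hl] using hy l
      refine ⟨fun l => ?_, hyl⟩
      by_cases hl : l = j
      · simpa only [if_pos hl] using hy l
      · have := hyl l hl
        have := hx.1 l
        have := hxi.1 l
        omega
    intro y hy hy'
    obtain ⟨hyB, hyl⟩ := hbox y hy
    refine plaqMem_bS2_of_facet hji.symm hi hj hyB (hbox _ hy').1 ?_ fun k _ hkj => ?_
    · have h1 := hyl α.1 hj.symm
      have h2 := hx.2.2
      have h3 := hxi.2.2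
      omega
    · have h1 := hyl k hkj
      have h2 := hx.2.1 k
      have h3 := hxi.2.1 k
      rw [Inner] at h2 h3 ⊢
      omega
  all_goals
    intro l
    have h1 := hx.1 l
    have h2 := hxi.1 l
    have h3 := hxx l
    dsimp only
    split_ifs <;> omega

/-- The trivialization of a flat connection near the boundary of `B` extends to the sites of the
boundary of `Λ`. -/
lemma exists_trivial_bS2_of_inner {H : Type*} [Group H] {s : Site → Fin 4 → H}
    (hN : ∀ k, Λ.a k + 2 ≤ Λ.b k) (hs : ∀ x i j, PlaqMem (bS2 B) x i j → FlatAt s x i j)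
    (h : ∃ g : Site → H, ∀ x i, EdgeMem (bS2 B) x i → (∀ l, Inner Λ x l ∧ Inner Λ (x + unit i) l) →
      s x i * g (x + unit i) = g x) :
    ∃ g : Site → H, ∀ x i, EdgeMem (bS2 B) x i → s x i * g (x + unit i) = g x := by
  have hD : ∀ D : Finset (Fin 4), ∃ g : Site → H, ∀ x i, EdgeMem (bS2 B) x i →
      (∀ l ∉ D, Inner Λ x l ∧ Inner Λ (x + unit i) l) → s x i * g (x + unit i) = g x := by
    intro D
    induction D using Finset.induction_on with
    | empty => simpa using h
    | insert j D hj ih =>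
      obtain ⟨g, hg⟩ := ih
      refine ⟨fun x => if x j = Λ.a j then s x j * g (x + unit j)
        else if x j = Λ.b j then (s (x - unit j) j)⁻¹ * g (x - unit j) else g x,
        fun x i hxi hD => ?_⟩
      have hNj := hN j
      have hΛ : Λ.mem x ∧ Λ.mem (x + unit i) := by
        obtain ⟨h1, h2, -⟩ := hxi.exists_edgeInComplex
        exact ⟨h1, h2⟩
      have hxj := hΛ.1 j
      have hgood : Inner Λ x j → Inner Λ (x + unit i) j → s x i * g (x + unit i) = g x := by
        intro h1 h2
        refine hg x i hxi fun l hl => ?_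
        by_cases hlj : l = j
        · subst hlj; exact ⟨h1, h2⟩
        · exact hD l (by simp [hlj, hl])
      rcases eq_or_ne i j with rfl | hij
      · have hxi' : (x + unit i) i = x i + 1 := by rw [Pi.add_apply, unit_apply_self]
        have hxj' := hΛ.2 i
        simp only [Inner, hxi'] at hgood hxj'
        simp only [hxi', add_sub_cancel_right]
        by_cases h1 : x i = Λ.a i
        · rw [if_neg (by omega), if_neg (by omega), if_pos h1]
        · by_cases h2 : x i + 1 = Λ.b i
          · rw [if_neg (by omega), if_pos h2, if_neg h1, if_neg (by omega), mul_inv_cancel_left]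
          · rw [if_neg (by omega), if_neg h2, if_neg h1, if_neg (by omega)]
            exact hgood (by omega) (by omega)
      · have hxi' : (x + unit i) j = x j := by
          rw [Pi.add_apply, unit_apply_of_ne hij.symm, add_zero]
        simp only [hxi']
        by_cases hin : Inner Λ x j
        · rw [if_neg hin.1.ne', if_neg hin.2.ne, if_neg hin.1.ne', if_neg hin.2.ne]
          exact hgood hin (by rw [Inner, hxi']; exact hin)
        have hperp : ∀ y m, PlaqMem (bS2 B) y i m → y j = x j → m = j := by
          intro y m hm hyj
          by_contra hmj
          have := (plaqMem_bS2.mp hm).2.2 j hij.symm (Ne.symm hmj)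
          rw [Inner] at hin
          omega
        have hgood' : ∀ y, EdgeMem (bS2 B) y i → (∀ l, l ≠ j → y l = x l) → Inner Λ y j →
            s y i * g (y + unit i) = g y := by
          intro y hy hyx hyj
          refine hg y i hy fun l hl => ?_
          by_cases hlj : l = j
          · subst hlj
            refine ⟨hyj, ?_⟩
            rw [Inner, Pi.add_apply, unit_apply_of_ne hij.symm, add_zero]
            exact hyj
          · have := hD l (by simp [hlj, hl])
            simpa only [Inner, Pi.add_apply, hyx l hlj] using this
        have hadd : ∀ (y : Site) m, m ≠ j → (y + unit m) j = y j := fun y m hm => by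
          rw [Pi.add_apply, unit_apply_of_ne hm.symm, add_zero]
        have hadd' : ∀ (y : Site) l, l ≠ j → (y + unit j) l = y l := fun y l hl => by
          rw [Pi.add_apply, unit_apply_of_ne hl, add_zero]
        have hself : ∀ y : Site, (y + unit j) j = y j + 1 := fun y => by
          rw [Pi.add_apply, unit_apply_self]
        rw [Inner] at hin
        by_cases h1 : x j = Λ.a j
        · rw [if_pos h1, if_pos h1]
          have hp : PlaqMem (bS2 B) x i j := by
            obtain ⟨m, hm | ⟨y, rfl, hm⟩⟩ := hxi
            · exact hperp x m hm rfl ▸ hm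
            · by_cases hmj : m = j
              · subst hmj
                have := hm.mem_box.2.1 m
                rw [hself] at h1
                omega
              · exact absurd (hperp y m hm (hadd y m hmj).symm) hmj
          have := hgood' (x + unit j) hp.edgeMem_add (fun l hl => hadd' x l hl)
            (by rw [Inner, hself]; omega)
          rw [← this, ← mul_assoc, ← mul_assoc, ← hs x i j hp, add_right_comm]
        · have h2 : x j = Λ.b j := by omega
          rw [if_neg h1, if_neg h1, if_pos h2, if_pos h2]
          obtain ⟨y, rfl, hp⟩ : ∃ y, x = y + unit j ∧ PlaqMem (bS2 B) y i j := by
            obtain ⟨m, hm | ⟨y, rfl, hm⟩⟩ := hxi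
            · obtain rfl := hperp x m hm rfl
              have := hm.mem_box.2.2 m
              rw [hself, hxi'] at this
              omega
            · by_cases hmj : m = j
              · exact ⟨y, by rw [hmj], hmj ▸ hm⟩
              · exact absurd (hperp y m hm (hadd y m hmj).symm) hmj
          have := hgood' y hp.edgeMem (fun l hl => (hadd' y l hl).symm)
            (by rw [hself] at h2; rw [Inner]; omega)
          have e1 : y + unit j + unit i - unit j = y + unit i := by abel
          rw [add_sub_cancel_right, e1, ← this, ← mul_assoc, ← mul_assoc]
          congr 1
          rw [mul_inv_eq_iff_eq_mul, mul_assoc, eq_inv_mul_iff_mul_eq]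
          exact (hs y i j hp).symm
  obtain ⟨g, hg⟩ := hD Finset.univ
  exact ⟨g, fun x i h => hg x i h (by simp)⟩

lemma simplyConnectedC_bS2 (hB : ∀ k, B.lo k < B.hi k)
    (hfull : ∀ k, Λ.a k < B.lo k ∨ B.hi k < Λ.b k) : SimplyConnectedC (bS2 B) := by
  have hN : ∀ k, Λ.a k + 2 ≤ Λ.b k := fun k => by
    have := hB k
    have := B.a_le_lo k
    have := B.hi_le_b k
    have := hfull k
    omega
  have hcover := cubeCover_innerFacet hB hfull
  have hedge : ∀ α ∈ freeFacets B, ∀ x i, x ∈ innerFacet B α → x + unit i ∈ innerFacet B α →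
      EdgeMem (bS2 B) x i := fun α hα x i => edgeMem_bS2_of_innerFacet hB hα
  refine simplyConnectedC_of_flat (fun f hf => ?_) (fun H _ s hs => ?_)
  · have hbase : ∀ x i j, PlaqMem (bS2 B) x i j →
        ∃ α ∈ freeFacets B, ∃ z ∈ innerFacet B α, (f x ↔ f z) := by
      intro x i j hp
      obtain ⟨α, hα, hi, hj, hxα⟩ := hp.exists_facet
      obtain ⟨hij, hx, hy⟩ := plaqMem_S2.mp (plaqMem_bS2.mp hp).1
      obtain ⟨hx1, hx2⟩ := mem_siteBox_of_add_unit hx hy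
      have hin := (plaqMem_bS2.mp hp).2.2
      have hΛ := hp.mem_box.2
      refine ⟨α, hα, ?_⟩
      simp only [mem_innerFacet hα hB]
      have hxin : ∀ k, k ≠ i → k ≠ j → Inner Λ x k := fun k hki hkj =>
        ⟨lt_of_le_of_ne (hΛ.1 k).1 (hin k hki hkj).1.symm,
          lt_of_le_of_ne (hΛ.1 k).2 (hin k hki hkj).2⟩
      suffices h : ∃ z ∈ siteBox B.lo B.hi, (f x ↔ f z) ∧ (∀ k, k ≠ i → k ≠ j → z k = x k) ∧
          Inner Λ z i ∧ Inner Λ z j by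
        obtain ⟨z, hz, hxz, hzx, hzi, hzj⟩ := h
        refine ⟨z, ⟨hz, fun k => ?_, (hzx _ hi.symm hj.symm).trans hxα⟩, hxz⟩
        by_cases hki : k = i
        · exact hki ▸ hzi
        by_cases hkj : k = j
        · exact hkj ▸ hzj
        rw [Inner, hzx k hki hkj]
        exact hxin k hki hkj
      have e1 : (x + unit i) i = x i + 1 := by simp [unit_apply_self]
      have e2 : (x + unit i) j = x j := by simp [unit_apply_of_ne hij.symm]
      have e3 : (x + unit j) i = x i := by simp [unit_apply_of_ne hij]
      have e4 : (x + unit j) j = x j + 1 := by simp [unit_apply_self]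
      have e5 : (x + unit i + unit j) i = x i + 1 := by
        simp [unit_apply_self, unit_apply_of_ne hij]
      have e6 : (x + unit i + unit j) j = x j + 1 := by
        simp [unit_apply_self, unit_apply_of_ne hij.symm]
      have h1 := hΛ.1 i
      have h2 := hΛ.1 j
      have h3 := hΛ.2 i
      have h4 := hΛ.2 j
      have h5 := hN i
      have h6 := hN j
      rw [e5] at h3
      rw [e6] at h4
      by_cases hxi : Λ.a i < x i <;> by_cases hxj : Λ.a j < x j
      · refine ⟨x, hx, Iff.rfl, fun _ _ _ => rfl, ?_, ?_⟩ <;> rw [Inner] <;> omega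
      · refine ⟨x + unit j, hx2, hf _ _ hp.symm.edgeMem, fun k hki hkj => ?_, ?_, ?_⟩
        · simp [unit_apply_of_ne hkj]
        all_goals rw [Inner]; omega
      · refine ⟨x + unit i, hx1, hf _ _ hp.edgeMem, fun k hki hkj => ?_, ?_, ?_⟩
        · simp [unit_apply_of_ne hki]
        all_goals rw [Inner]; omega
      · refine ⟨x + unit i + unit j, hy,
          (hf _ _ hp.edgeMem).trans (hf _ _ hp.symm.edgeMem_add), fun k hki hkj => ?_, ?_, ?_⟩
        · simp [unit_apply_of_ne hki, unit_apply_of_ne hkj]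
        all_goals rw [Inner]; omega
    intro x i j y k l hx hy hfx
    obtain ⟨α, hα, z, hz, hxz⟩ := hbase x i j hx
    obtain ⟨β, hβ, w, hw, hyw⟩ := hbase y k l hy
    exact hyw.mpr (hcover.forall_imp (fun γ hγ z m hz hzm => hf z m (hedge γ hγ z m hz hzm))
      α hα β hβ z hz w hw (hxz.mp hfx))
  · refine exists_trivial_bS2_of_inner hN hs ?_
    obtain ⟨g, hg⟩ := hcover.exists_trivialOn (s := s) (fun α hα => by
      have hplaq : ∀ x i j, i ≠ j → x ∈ innerFacet B α → x + unit i + unit j ∈ innerFacet B α →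
          PlaqMem (bS2 B) x i j := by
        intro x i j hij hx hy
        rw [mem_innerFacet hα hB] at hx hy
        have hadd : (x + unit i + unit j) α.1 = x α.1 + unit i α.1 + unit j α.1 := rfl
        have h1 := hx.2.2
        have h2 := hy.2.2
        have h3 := unit_apply_nonneg i α.1
        have h4 := unit_apply_nonneg j α.1
        refine plaqMem_bS2_of_facet hij ?_ ?_ hx.1 hy.1 hx.2.2 fun k _ _ => hx.2.1 k
        · rintro rfl
          rw [unit_apply_self] at hadd
          omega
        · rintro rfl
          rw [unit_apply_self] at hadd
          omega
      obtain ⟨c, hc⟩ : (innerFacet B α).Nonempty := by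
        obtain ⟨β, hβ, hne, -⟩ := hcover.exists_dir_ne α.1 α.1
        exact (hcover.inter_nonempty hα hβ hne.symm).left
      exact exists_trivialOn_siteBox hc 0
        (fun x i hi hx hy => hs _ _ _ (hplaq _ _ _ hi hx hy))
        (fun x i k hik _ _ _ hx hy => hs _ _ _ (hplaq _ _ _ hik hx hy)))
    refine ⟨g, fun x i hxi hin => ?_⟩
    obtain ⟨α, hα, hx, hx', h⟩ : ∃ α ∈ freeFacets B, x ∈ siteBox B.lo B.hi ∧
        x + unit i ∈ siteBox B.lo B.hi ∧
        x α.1 = facetPos B α ∧ (x + unit i) α.1 = facetPos B α := by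
      have hbox : ∀ y j, PlaqMem (bS2 B) y i j → _ := fun y j h =>
        plaqMem_S2.mp (plaqMem_bS2.mp h).1
      obtain ⟨j, h | ⟨y, rfl, h⟩⟩ := hxi
      · obtain ⟨α, hα, hi, hj, hxα⟩ := h.exists_facet
        obtain ⟨-, h1, h2⟩ := hbox _ _ h
        refine ⟨α, hα, h1, (mem_siteBox_of_add_unit h1 h2).1, hxα, ?_⟩
        rwa [Pi.add_apply, unit_apply_of_ne hi.symm, add_zero]
      · obtain ⟨α, hα, hi, hj, hxα⟩ := h.exists_facet
        obtain ⟨-, h1, h2⟩ := hbox _ _ h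
        refine ⟨α, hα, (mem_siteBox_of_add_unit h1 h2).2, by rwa [add_right_comm], ?_⟩
        simp only [Pi.add_apply, unit_apply_of_ne hi.symm, unit_apply_of_ne hj.symm, add_zero]
        exact ⟨hxα, hxα⟩
    exact hg α hα x i ((mem_innerFacet hα hB).mpr ⟨hx, fun k => (hin k).1, h.1⟩)
      ((mem_innerFacet hα hB).mpr ⟨hx', fun k => (hin k).2, h.2⟩)

/-- A rectangle that is non-degenerate and spans `Λ` in no direction is good. -/
theorem goodRect_of_lt (hB : ∀ k, B.lo k < B.hi k)
    (hfull : ∀ k, Λ.a k < B.lo k ∨ B.hi k < Λ.b k) : GoodRect B :=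
  ⟨simplyConnectedC_S2 hB, simplyConnectedC_S2c hB hfull, simplyConnectedC_bS2 hB hfull⟩

end Boundary

section Separation

variable {Λ : Box}

/-- All the corners of the plaquette `p` lie in the box with opposite corners `lo`, `hi`. -/
def Plaq.InBox (p : Plaq Λ) (lo hi : Site) : Prop :=
  p.1.1 ∈ siteBox lo hi ∧ p.1.1 + unit p.1.2.1 + unit p.1.2.2 ∈ siteBox lo hi

lemma Plaq.InBox.mono {p : Plaq Λ} {lo hi lo' hi' : Site} (h : p.InBox lo hi) (hlo : lo' ≤ lo)
    (hhi : hi ≤ hi') : p.InBox lo' hi' :=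
  ⟨fun i => ⟨(hlo i).trans (h.1 i).1, (h.1 i).2.trans (hhi i)⟩,
    fun i => ⟨(hlo i).trans (h.2 i).1, (h.2 i).2.trans (hhi i)⟩⟩

lemma Plaq.inBox_self (p : Plaq Λ) : p.InBox Λ.a Λ.b := ⟨p.2.2.1, p.2.2.2.2.1⟩

lemma Plaq.exists_inBox (p : Plaq Λ) :
    ∃ lo hi : Site, p.InBox lo hi ∧ ∀ i, hi i - lo i ≤ 1 := by
  have hne : p.1.2.1 ≠ p.1.2.2 := p.2.1.ne
  have key : ∀ i, unit p.1.2.1 i + unit p.1.2.2 i ≤ 1 := by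
    intro i
    simp only [unit]
    split_ifs with h1 h2
    · exact absurd (h1.symm.trans h2) hne
    all_goals norm_num
  have h0 : ∀ i, 0 ≤ unit p.1.2.1 i + unit p.1.2.2 i := fun i =>
    add_nonneg (unit_apply_nonneg _ _) (unit_apply_nonneg _ _)
  refine ⟨p.1.1, p.1.1 + unit p.1.2.1 + unit p.1.2.2,
    ⟨fun i => ⟨le_rfl, ?_⟩, fun i => ⟨?_, le_rfl⟩⟩,
    fun i => ?_⟩
  all_goals
    simp only [Pi.add_apply]
    have h1 := key i
    have h2 := h0 i
    linarith

/-- A set of plaquettes that cannot be split into two well separated parts. -/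
def Unsplittable (K : Set (Plaq Λ)) : Prop :=
  ¬ ∃ K₁ K₂ : Set (Plaq Λ), K₁.Nonempty ∧ K₂.Nonempty ∧ Disjoint K₁ K₂ ∧ K₁ ∪ K₂ = K ∧
    WellSepGood K₁ K₂

/-- A proper part of an unsplittable set has another plaquette of that set nearby, unless the part
nearly spans the whole lattice. -/
theorem Unsplittable.exists_near {K A : Set (Plaq Λ)} (hK : Unsplittable K) (hA : A.Nonempty)
    (hAK : A ⊂ K) {lo hi : Site} {s : ℤ} (hin : ∀ p ∈ A, p.InBox lo hi)
    (hs : ∀ i, hi i - lo i ≤ s) :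
    ∃ q ∈ K \ A, (∀ i, Λ.b i - Λ.a i ≤ s + 2) ∨ ∀ i, lo i - 1 ≤ q.1.1 i ∧ q.1.1 i ≤ hi i + 1 := by
  obtain ⟨q₀, hq₀, hq₀A⟩ := Set.exists_of_ssubset hAK
  by_cases hN : ∀ i, Λ.b i - Λ.a i ≤ s + 2
  · exact ⟨q₀, ⟨hq₀, hq₀A⟩, Or.inl hN⟩
  replace hN : ∀ i, s + 2 < Λ.b i - Λ.a i := by
    push Not at hN
    obtain ⟨i, hi⟩ := hN
    intro j
    rw [Λ.side_eq j i]
    exact hi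
  obtain ⟨p₀, hp₀⟩ := hA
  have h₀ := fun i => And.intro ((hin p₀ hp₀).1 i) (p₀.2.2.1 i)
  have hlt : ∀ k, max (lo k - 1) (Λ.a k) < min (hi k + 1) (Λ.b k) := by
    intro k
    have := h₀ k
    have := hs k
    have := hN k
    omega
  let B : Rect Λ := ⟨fun k => max (lo k - 1) (Λ.a k), fun k => min (hi k + 1) (Λ.b k),
    fun k => (hlt k).le, fun k => le_max_right _ _, fun k => min_le_right _ _⟩
  have hgood : GoodRect B := by
    refine goodRect_of_lt hlt fun k => ?_
    have := hs k
    have := hN k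
    change Λ.a k < max (lo k - 1) (Λ.a k) ∨ min (hi k + 1) (Λ.b k) < Λ.b k
    omega
  have hAB : A ⊆ S2 B := by
    intro p hp
    refine (B.plaqIn_iff (Or.inl rfl)).mpr ⟨fun k => ?_, fun k => ?_⟩
    · have h1 := (hin p hp).1 k
      have h2 := p.2.2.1 k
      change max (lo k - 1) (Λ.a k) ≤ p.1.1 k ∧ p.1.1 k ≤ min (hi k + 1) (Λ.b k)
      omega
    · have h1 := (hin p hp).2 k
      have h2 := p.2.2.2.2.1 k
      exact ⟨max_le (by linarith [h1.1]) h2.1, le_min (by linarith [h1.2]) h2.2⟩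
  have hAb : ∀ p ∈ A, p ∉ bS2 B := by
    rintro p hp ⟨⟨-, k, hk1, hk2, h⟩, hb⟩
    refine hb ⟨k, hk1, hk2, ?_⟩
    have h1 := (hin p hp).1 k
    have h2 := p.2.2.1 k
    change p.1.1 k = max (lo k - 1) (Λ.a k) ∨ p.1.1 k = min (hi k + 1) (Λ.b k) at h
    omega
  by_contra! hfar
  have hout : ∀ q ∈ K \ A, ¬ B.plaqIn q := by
    intro q hq hqB
    obtain ⟨i, hi⟩ := (hfar q hq).2
    have h1 := ((B.plaqIn_iff (Or.inl rfl)).mp hqB).1 i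
    change max (lo i - 1) (Λ.a i) ≤ q.1.1 i ∧ q.1.1 i ≤ min (_ + 1) (Λ.b i) at h1
    have := hi (by omega)
    omega
  refine hK ⟨A, K \ A, ⟨p₀, hp₀⟩, ⟨q₀, hq₀, hq₀A⟩, Set.disjoint_sdiff_right,
    Set.union_sdiff_cancel hAK.subset, B, hgood, hAB, fun q hq => Or.inl (hout q hq), ?_⟩
  rintro p (hp | hp)
  exacts [hAb p hp, fun h => hout p hp h.1.1]

/-- The plaquettes of `A` fit in a box whose sides are at most `s`. -/
def FitsIn (A : Set (Plaq Λ)) (s : ℤ) : Prop :=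
  ∃ lo hi : Site, (∀ p ∈ A, p.InBox lo hi) ∧ ∀ i, hi i - lo i ≤ s

/-- A proper part `A` of an unsplittable set has a neighbour `q` in that set, such that any other
part containing `q` can be merged with `A` at a small cost. -/
theorem Unsplittable.exists_merge {K A : Set (Plaq Λ)} (hK : Unsplittable K) (hA : A.Nonempty)
    (hAK : A ⊂ K) {s : ℤ} (hs : FitsIn A s) :
    ∃ q ∈ K \ A, (∀ p ∈ A, ∀ i, |p.1.1 i - q.1.1 i| ≤ s + 2) ∧
      ∀ (A' : Set (Plaq Λ)) (s' : ℤ), 1 ≤ s' → q ∈ A' → FitsIn A' s' →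
        FitsIn (A ∪ A') (s + s' + 1) := by
  obtain ⟨lo, hi, hin, hs⟩ := hs
  obtain ⟨q, hq, h | h⟩ := hK.exists_near hA hAK hin hs
  · refine ⟨q, hq, fun p _ i => ?_, fun A' s' hs' _ _ => ⟨Λ.a, Λ.b, fun p _ => p.inBox_self,
      fun i => (h i).trans (by linarith)⟩⟩
    have h1 := p.2.2.1 i
    have h2 := q.2.2.1 i
    have h3 := h i
    rw [abs_le]
    constructor <;> linarith [h1.1, h1.2, h2.1, h2.2]
  · refine ⟨q, hq, fun p hp i => ?_, fun A' s' hs' hqA' ⟨lo', hi', hin', hs''⟩ =>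
      ⟨lo ⊓ lo', hi ⊔ hi', ?_, fun i => ?_⟩⟩
    · have h1 := (hin p hp).1 i
      have h2 := h i
      have h3 := hs i
      rw [abs_le]
      constructor <;> linarith [h1.1, h1.2, h2.1, h2.2]
    · rintro p (hp | hp)
      exacts [(hin p hp).mono inf_le_left le_sup_left, (hin' p hp).mono inf_le_right le_sup_right]
    · obtain ⟨p, hp⟩ := hA
      have h1 := (hin' q hqA').1 i
      have h2 := (hin p hp).1 i
      have h3 := h i
      have h4 := hs i
      have h5 := hs'' i
      simp only [Pi.sup_apply, Pi.inf_apply]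
      omega

end Separation

section Tours

variable {α : Type*} {W : α → α → ℝ}

/-- The product of the weights of the steps of a path. -/
def pathWeight (W : α → α → ℝ) : List α → ℝ
  | [] => 1
  | [_] => 1
  | x :: y :: l => W x y * pathWeight W (y :: l)

lemma pathWeight_nonneg (hW : ∀ x y, 0 ≤ W x y) : ∀ l, 0 ≤ pathWeight W l
  | [] => zero_le_one
  | [_] => zero_le_one
  | _ :: y :: l => mul_nonneg (hW _ _) (pathWeight_nonneg hW (y :: l))

lemma pathWeight_append_cons (x : α) (v : List α) : ∀ u,
    pathWeight W (u ++ x :: v) = pathWeight W (u ++ [x]) * pathWeight W (x :: v)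
  | [] => by simp [pathWeight]
  | [y] => by simp [pathWeight]
  | y :: z :: u => by
    have := pathWeight_append_cons x v (z :: u)
    simp only [List.cons_append, pathWeight] at this ⊢
    rw [this, mul_assoc]

lemma sum_pathWeight_le [Fintype α] (hW : ∀ x y, 0 ≤ W x y) (hsum : ∀ x, ∑ y, W x y ≤ 1)
    (n : ℕ) (x : α) :
    ∑ f : Fin n → α, pathWeight W (x :: List.ofFn f) ≤ 1 := by
  induction n generalizing x with
  | zero => simp [pathWeight]
  | succ n ih =>
    rw [← (Fin.consEquiv fun _ : Fin (n + 1) => α).sum_comp, Fintype.sum_prod_type]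
    simp only [Fin.consEquiv, Equiv.coe_fn_mk, List.ofFn_cons, pathWeight, ← Finset.mul_sum]
    exact (Finset.sum_le_sum fun y _ => mul_le_of_le_one_right (hW x y) (ih y)).trans (hsum x)

variable [DecidableEq α]

/-- `A` is visited from any of its points by a closed path with `2 |A| - 2` steps whose weight is
at least `ω`. -/
def HasTours (W : α → α → ℝ) (A : Finset α) (ω : ℝ) : Prop :=
  ∀ x ∈ A, ∃ l : List α, l.head? = some x ∧ l.getLast? = some x ∧ l.toFinset = A ∧
    l.length + 1 = 2 * A.card ∧ ω ≤ pathWeight W l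

lemma hasTours_singleton (x : α) : HasTours W {x} 1 := by
  intro y hy
  obtain rfl := Finset.mem_singleton.mp hy
  exact ⟨[y], by simp [pathWeight]⟩

lemma HasTours.mono {A : Finset α} {ω ω' : ℝ} (h : HasTours W A ω) (hω : ω' ≤ ω) :
    HasTours W A ω' := by
  intro x hx
  obtain ⟨l, h1, h2, h3, h4, h5⟩ := h x hx
  exact ⟨l, h1, h2, h3, h4, hω.trans h5⟩

lemma HasTours.union_aux (hW : ∀ x y, 0 ≤ W x y) {A B : Finset α}
    {ω ω' : ℝ} (hA : HasTours W A ω) (hB : HasTours W B ω') (hω' : 0 ≤ ω')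
    (hdisj : Disjoint A B) {a b : α} (ha : a ∈ A) (hb : b ∈ B) {x : α} (hx : x ∈ A) :
    ∃ l : List α, l.head? = some x ∧ l.getLast? = some x ∧ l.toFinset = A ∪ B ∧
      l.length + 1 = 2 * (A ∪ B).card ∧ ω * ω' * (W a b * W b a) ≤ pathWeight W l := by
  obtain ⟨l, h1, h2, h3, h4, h5⟩ := hA x hx
  obtain ⟨l', h1', h2', h3', h4', h5'⟩ := hB b hb
  rw [← h3, List.mem_toFinset] at ha
  obtain ⟨u, v, rfl⟩ := List.append_of_mem ha
  obtain ⟨r, rfl⟩ := List.getLast?_eq_some_iff.mp h2'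
  obtain ⟨t, ht⟩ := List.head?_eq_some_iff.mp h1'
  refine ⟨u ++ a :: ((r ++ [b]) ++ a :: v), ?_, ?_, ?_, ?_, ?_⟩
  · simpa [List.head?_append] using h1
  · rw [← List.cons_append, ← List.append_assoc]
    simpa [List.getLast?_append, List.getLast?_cons] using h2
  · rw [← h3, ← h3']
    ext z
    simp only [List.mem_toFinset, Finset.mem_union, List.mem_append, List.mem_cons]
    tauto
  · rw [Finset.card_union_of_disjoint hdisj]
    simp only [List.length_append, List.length_cons] at h4 h4' ⊢
    omega
  · have e1 : pathWeight W (a :: (r ++ [b] ++ a :: v)) =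
        W a b * (pathWeight W (r ++ [b]) * (W b a * pathWeight W (a :: v))) := by
      rw [← pathWeight, ← pathWeight_append_cons, ht, List.cons_append, pathWeight,
        ← List.cons_append, ← ht, List.append_assoc, List.singleton_append]
    rw [pathWeight_append_cons, e1]
    rw [pathWeight_append_cons] at h5
    calc ω * ω' * (W a b * W b a)
        ≤ pathWeight W (u ++ [a]) * pathWeight W (a :: v) * pathWeight W (r ++ [b]) *
            (W a b * W b a) := by
          refine mul_le_mul_of_nonneg_right (mul_le_mul h5 h5' hω' ?_)
            (mul_nonneg (hW _ _) (hW _ _))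
          exact mul_nonneg (pathWeight_nonneg hW _) (pathWeight_nonneg hW _)
      _ = _ := by ring

lemma HasTours.union (hW : ∀ x y, 0 ≤ W x y) {A B : Finset α}
    {ω ω' : ℝ} (hA : HasTours W A ω) (hB : HasTours W B ω') (hω : 0 ≤ ω) (hω' : 0 ≤ ω')
    (hdisj : Disjoint A B) {a b : α} (ha : a ∈ A) (hb : b ∈ B) :
    HasTours W (A ∪ B) (ω * ω' * (W a b * W b a)) := by
  intro x hx
  rcases Finset.mem_union.mp hx with hx | hx
  · exact hA.union_aux hW hB hω' hdisj ha hb hx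
  · rw [Finset.union_comm, mul_comm ω, mul_comm (W a b)]
    exact hB.union_aux hW hA hω hdisj.symm hb ha hx

/-- The number of sets of size `m` through a given point with tours of weight at least `ω` is at
most `ω⁻¹`. -/
theorem card_mul_le_of_hasTours [Fintype α] (hW : ∀ x y, 0 ≤ W x y) (hsum : ∀ x, ∑ y, W x y ≤ 1)
    (x : α) (m : ℕ) (ω : ℝ) (S : Finset (Finset α))
    (hS : ∀ A ∈ S, x ∈ A ∧ A.card = m ∧ HasTours W A ω) : S.card * ω ≤ 1 := by
  have key : ∀ A ∈ S, ∃ f : Fin (2 * m - 2) → α, (x :: List.ofFn f).toFinset = A ∧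
      ω ≤ pathWeight W (x :: List.ofFn f) := by
    intro A hA
    obtain ⟨hx, hm, h⟩ := hS A hA
    obtain ⟨l, h1, -, h3, h4, h5⟩ := h x hx
    obtain ⟨t, rfl⟩ := List.head?_eq_some_iff.mp h1
    have hlen : 2 * m - 2 = t.length := by
      rw [List.length_cons] at h4
      omega
    rw [hlen]
    exact ⟨t.get, by rwa [List.ofFn_get], by rwa [List.ofFn_get]⟩
  have : Nonempty α := ⟨x⟩
  choose! F hF hF' using key
  have hinj : Set.InjOn F S := fun A hA B hB h => by rw [← hF A hA, ← hF B hB, h]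
  calc (S.card : ℝ) * ω = ∑ A ∈ S, ω := by rw [Finset.sum_const, nsmul_eq_mul]
    _ ≤ ∑ A ∈ S, pathWeight W (x :: List.ofFn (F A)) := Finset.sum_le_sum hF'
    _ = ∑ f ∈ S.image F, pathWeight W (x :: List.ofFn f) := by rw [Finset.sum_image hinj]
    _ ≤ ∑ f, pathWeight W (x :: List.ofFn f) :=
      Finset.sum_le_univ_sum_of_nonneg fun f => pathWeight_nonneg hW _
    _ ≤ 1 := sum_pathWeight_le hW hsum _ x

/-- If a smallest part of a partition can always be merged with another part, while keeping the
property `P`, then `P` passes from the singletons to the whole set. -/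
theorem merge_induction {P : Finset α → Prop} {K : Finset α} (hK : K.Nonempty)
    (hsingle : ∀ x ∈ K, P {x})
    (hmerge : ∀ A, A.Nonempty → A ⊂ K → P A → ∃ q ∈ K \ A, ∀ B ⊆ K, Disjoint A B → q ∈ B →
      A.card ≤ B.card → P B → P (A ∪ B)) : P K := by
  have main : ∀ (n : ℕ) (S : Finset (Finset α)), S.card = n →
      (S : Set (Finset α)).PairwiseDisjoint id → S.biUnion id = K → (∀ A ∈ S, A.Nonempty ∧ P A) → P K := by
    intro n
    induction n using Nat.strong_induction_on with
    | _ n ih =>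
      intro S hn hd hS hP
      have hSne : S.Nonempty := by
        obtain ⟨x, hx⟩ := hK
        rw [← hS, Finset.mem_biUnion] at hx
        obtain ⟨A, hA, -⟩ := hx
        exact ⟨A, hA⟩
      obtain ⟨A, hA, hmin⟩ := S.exists_min_image Finset.card hSne
      have hsub : ∀ B ∈ S, B ⊆ K := fun B hB => hS ▸ Finset.subset_biUnion_of_mem id hB
      rcases (hsub A hA).eq_or_ssubset with rfl | hAK
      · exact (hP A hA).2
      obtain ⟨q, hq, hmerge⟩ := hmerge A (hP A hA).1 hAK (hP A hA).2
      rw [Finset.mem_sdiff] at hq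
      obtain ⟨B, hB, hqB⟩ := Finset.mem_biUnion.mp (hS ▸ hq.1)
      have hAB : A ≠ B := fun h => hq.2 (h ▸ hqB)
      have hBA : B ∈ S.erase A := Finset.mem_erase.mpr ⟨hAB.symm, hB⟩
      have hrest : ∀ C ∈ (S.erase A).erase B, C ≠ B ∧ C ≠ A ∧ C ∈ S := by simp
      refine ih _ ?_ (insert (A ∪ B) ((S.erase A).erase B)) rfl ?_ ?_ ?_
      · have h1 := Finset.card_insert_le (A ∪ B) ((S.erase A).erase B)
        have h2 := Finset.card_erase_add_one hBA
        have h3 := Finset.card_erase_add_one hA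
        omega
      · rw [Finset.coe_insert, Set.pairwiseDisjoint_insert]
        refine ⟨fun C hC D hD => hd (hrest C hC).2.2 (hrest D hD).2.2, fun C hC _ => ?_⟩
        obtain ⟨h1, h2, h3⟩ := hrest C hC
        exact Finset.disjoint_union_left.mpr ⟨hd hA h3 h2.symm, hd hB h3 h1.symm⟩
      · rw [← hS, ← Finset.insert_erase hA, ← Finset.insert_erase hBA]
        simp only [Finset.biUnion_insert, Finset.erase_insert_eq_erase, id, Finset.union_assoc]
        rw [Finset.insert_erase hBA, Finset.erase_idem]
      · intro C hC
        rcases Finset.mem_insert.mp hC with rfl | hC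
        · exact ⟨(hP A hA).1.mono Finset.subset_union_left, hmerge B (hsub B hB)
            (hd hA hB hAB) hqB (hmin B hB) (hP B hB).2⟩
        · exact hP C (hrest C hC).2.2
  refine main _ (K.image singleton) rfl ?_ ?_ ?_
  · intro A hA B hB hAB
    simp only [Finset.coe_image, Set.mem_image] at hA hB
    obtain ⟨x, -, rfl⟩ := hA
    obtain ⟨y, -, rfl⟩ := hB
    exact Finset.disjoint_singleton.mpr fun h => hAB (h ▸ rfl)
  · ext x
    simp
  · intro A hA
    obtain ⟨x, hx, rfl⟩ := Finset.mem_image.mp hA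
    exact ⟨Finset.singleton_nonempty x, hsingle x hx⟩

end Tours

section Counting

/-- The summable weight `(1 + |z|)⁻²` of an integer. -/
def invSq (z : ℤ) : ℝ := (((z.natAbs + 1 : ℕ) : ℝ) ^ 2)⁻¹

lemma invSq_nonneg (z : ℤ) : 0 ≤ invSq z := inv_nonneg.mpr (sq_nonneg _)

lemma invSq_neg (z : ℤ) : invSq (-z) = invSq z := by rw [invSq, invSq, Int.natAbs_neg]

lemma le_invSq {z n : ℤ} (hn : 1 ≤ n) (h : |z| ≤ 2 * n + 1) :
    ((4 * (n : ℝ)) ^ 2)⁻¹ ≤ invSq z := by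
  have h1 : ((z.natAbs + 1 : ℕ) : ℝ) ≤ 4 * n := by
    rw [Nat.cast_add, Nat.cast_natAbs, Nat.cast_one]
    exact_mod_cast (by linarith : |z| + 1 ≤ 4 * n)
  have h2 : (0 : ℝ) < ((z.natAbs + 1 : ℕ) : ℝ) := by positivity
  exact inv_anti₀ (pow_pos h2 2) (pow_le_pow_left₀ h2.le h1 2)

lemma sum_inv_sq_le_two (T : Finset ℕ) (hT : 0 ∉ T) : ∑ n ∈ T, ((n : ℝ) ^ 2)⁻¹ ≤ 2 := by
  have hsub : T ⊆ Finset.Ioo 0 (T.sup id + 1) := fun n hn => Finset.mem_Ioo.mpr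
    ⟨Nat.pos_of_ne_zero (ne_of_mem_of_not_mem hn hT), Nat.lt_succ_of_le (T.le_sup (f := id) hn)⟩
  have h := sum_Ioo_inv_sq_le (α := ℝ) 0 (T.sup id + 1)
  norm_num at h
  refine (Finset.sum_le_sum_of_subset_of_nonneg hsub fun _ _ _ => ?_).trans h
  positivity

lemma sum_invSq_le_four (S : Finset ℤ) : ∑ z ∈ S, invSq z ≤ 4 := by
  have key : ∀ T : Finset ℤ, Set.InjOn Int.natAbs T → ∑ z ∈ T, invSq z ≤ 2 := by
    intro T hT
    have hinj : Set.InjOn (fun z : ℤ => z.natAbs + 1) T := fun x hx y hy h =>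
      hT hx hy (Nat.succ_injective h)
    have h := sum_inv_sq_le_two (T.image fun z : ℤ => z.natAbs + 1) (by simp)
    rwa [Finset.sum_image hinj] at h
  rw [← Finset.sum_filter_add_sum_filter_not S (0 ≤ ·)]
  have h1 := key (S.filter (0 ≤ ·)) fun x hx y hy h => by
    simp only [Finset.coe_filter, Set.mem_ofPred_eq] at hx hy
    omega
  have h2 := key (S.filter (¬ 0 ≤ ·)) fun x hx y hy h => by
    simp only [Finset.coe_filter, Set.mem_ofPred_eq] at hx hy
    omega
  linarith

variable {Λ : Box}

instance : Finite (Plaq Λ) := by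
  have : Finite {x : Site // Λ.mem x} := by
    refine Finite.Set.subset (Set.Icc Λ.a Λ.b) ?_
    exact fun x hx => ⟨fun i => (hx i).1, fun i => (hx i).2⟩
  refine Finite.of_injective
    (fun p : Plaq Λ => ((⟨p.1.1, p.2.2.1⟩, p.1.2) : {x : Site // Λ.mem x} × Fin 4 × Fin 4)) ?_
  intro p q h
  simp only [Prod.mk.injEq, Subtype.mk.injEq] at h
  exact Subtype.ext (Prod.ext h.1 h.2)

instance : Fintype (Plaq Λ) := Fintype.ofFinite _

/-- The weight of a step between two plaquettes. -/
def stepWeight (p q : Plaq Λ) : ℝ := (∏ i, invSq (p.1.1 i - q.1.1 i)) / 4096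

lemma stepWeight_nonneg (p q : Plaq Λ) : 0 ≤ stepWeight p q :=
  div_nonneg (Finset.prod_nonneg fun _ _ => invSq_nonneg _) (by norm_num)

lemma stepWeight_comm (p q : Plaq Λ) : stepWeight p q = stepWeight q p := by
  unfold stepWeight
  congr 1
  exact Finset.prod_congr rfl fun i _ => by rw [← invSq_neg, neg_sub]

lemma sum_stepWeight_le (p : Plaq Λ) : ∑ q, stepWeight p q ≤ 1 := by
  simp only [stepWeight]
  rw [← Finset.sum_div, div_le_one (by norm_num)]
  let S : Finset Site := Fintype.piFinset fun i => Finset.Icc (Λ.a i) (Λ.b i)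
  let f : Site × Fin 4 × Fin 4 → ℝ := fun z => ∏ i, invSq (p.1.1 i - z.1 i)
  have hf : ∀ z, 0 ≤ f z := fun z => Finset.prod_nonneg fun _ _ => invSq_nonneg _
  have hS : ∑ z ∈ S, ∏ i, invSq (p.1.1 i - z i) ≤ 4 ^ 4 := by
    refine (Finset.prod_univ_sum _ fun i z => invSq (p.1.1 i - z)).symm.trans_le ?_
    refine (Finset.prod_le_prod (g := fun _ => (4 : ℝ))
      (fun i _ => Finset.sum_nonneg fun _ _ => invSq_nonneg _) fun i _ => ?_).trans (by simp)
    have h := sum_invSq_le_four ((Finset.Icc (Λ.a i) (Λ.b i)).image fun z => p.1.1 i - z)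
    rwa [Finset.sum_image fun x _ y _ h => by simpa using h] at h
  calc ∑ q : Plaq Λ, f q.1
      = ∑ z ∈ Finset.univ.image (Subtype.val : Plaq Λ → _), f z := by
        rw [Finset.sum_image Subtype.val_injective.injOn]
    _ ≤ ∑ z ∈ S ×ˢ Finset.univ, f z := by
        refine Finset.sum_le_sum_of_subset_of_nonneg ?_ fun z _ _ => hf z
        intro z hz
        obtain ⟨q, -, rfl⟩ := Finset.mem_image.mp hz
        refine Finset.mem_product.mpr ⟨Fintype.mem_piFinset.mpr fun i => ?_, Finset.mem_univ _⟩
        exact Finset.mem_Icc.mpr (q.2.2.1 i)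
    _ = 16 * ∑ z ∈ S, ∏ i, invSq (p.1.1 i - z i) := by
        rw [Finset.sum_product, Finset.mul_sum]
        refine Finset.sum_congr rfl fun z _ => ?_
        simp [f]
    _ ≤ 4096 := by linarith

lemma le_stepWeight {p q : Plaq Λ} {n : ℤ} (hn : 1 ≤ n)
    (h : ∀ i, |p.1.1 i - q.1.1 i| ≤ 2 * n + 1) :
    ((4 * (n : ℝ)) ^ 8)⁻¹ / 4096 ≤ stepWeight p q := by
  refine div_le_div_of_nonneg_right ?_ (by norm_num)
  calc ((4 * (n : ℝ)) ^ 8)⁻¹ = ∏ _i : Fin 4, ((4 * (n : ℝ)) ^ 2)⁻¹ := by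
        rw [Finset.prod_const, Finset.card_fin, inv_pow, ← pow_mul]
    _ ≤ _ := Finset.prod_le_prod (fun _ _ => by positivity) fun i _ => le_invSq hn (h i)

/-- The lower bound for the weight of the tours of a set of `n` plaquettes. -/
def tourBound (n : ℕ) : ℝ := 10 ^ 24 * (n : ℝ) ^ 16 / (10 ^ 24) ^ n

lemma tourBound_nonneg (n : ℕ) : 0 ≤ tourBound n := by unfold tourBound; positivity

lemma tourBound_add_le {m n : ℕ} (hm : 1 ≤ m) (hmn : m ≤ n) {w : ℝ}
    (hw : ((4 * (m : ℝ)) ^ 8)⁻¹ / 4096 ≤ w) :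
    tourBound (m + n) ≤ tourBound m * tourBound n * (w * w) := by
  have hm' : (1 : ℝ) ≤ m := by exact_mod_cast hm
  have hmn' : (m : ℝ) ≤ n := by exact_mod_cast hmn
  have hsum : ((m : ℝ) + n) ^ 16 ≤ (2 * n) ^ 16 :=
    pow_le_pow_left₀ (by positivity) (by linarith) 16
  calc tourBound (m + n) = 10 ^ 24 * ((m : ℝ) + n) ^ 16 / ((10 ^ 24) ^ m * (10 ^ 24) ^ n) := by
        rw [tourBound, pow_add, Nat.cast_add]
    _ ≤ 10 ^ 24 * (10 ^ 24 * (n : ℝ) ^ 16 / (4 ^ 16 * 4096 ^ 2)) /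
          ((10 ^ 24) ^ m * (10 ^ 24) ^ n) := by
        refine div_le_div_of_nonneg_right (mul_le_mul_of_nonneg_left ?_ (by norm_num))
          (by positivity)
        rw [le_div_iff₀ (by norm_num)]
        have h : (0 : ℝ) ≤ (n : ℝ) ^ 16 := by positivity
        rw [mul_pow] at hsum
        linarith
    _ = tourBound m * tourBound n *
          ((((4 * (m : ℝ)) ^ 8)⁻¹ / 4096) * (((4 * (m : ℝ)) ^ 8)⁻¹ / 4096)) := by
        unfold tourBound
        field_simp
    _ ≤ _ := by
        refine mul_le_mul_of_nonneg_left ?_ (mul_nonneg (tourBound_nonneg _) (tourBound_nonneg _))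
        exact mul_self_le_mul_self (by positivity) hw

/-- Unsplittable sets have tours of large weight. -/
theorem Unsplittable.hasTours {K : Finset (Plaq Λ)} (hK : Unsplittable (K : Set (Plaq Λ)))
    (hne : K.Nonempty) : HasTours stepWeight K (tourBound K.card) := by
  refine (merge_induction (P := fun A : Finset (Plaq Λ) =>
    FitsIn (A : Set (Plaq Λ)) (2 * A.card - 1) ∧ HasTours stepWeight A (tourBound A.card))
    hne ?_ ?_).2
  · intro p _
    obtain ⟨lo, hi, hp, h⟩ := p.exists_inBox
    refine ⟨⟨lo, hi, by simpa using hp, by simpa using h⟩, ?_⟩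
    simpa [tourBound] using hasTours_singleton p
  · rintro A hA hAK ⟨hfit, htour⟩
    obtain ⟨q, hq, hnear, hmerge⟩ := hK.exists_merge hA (Finset.coe_ssubset.mpr hAK) hfit
    refine ⟨q, by simpa using hq, ?_⟩
    rintro B - hAB hqB hcard ⟨hfit', htour'⟩
    have hApos := hA.card_pos
    obtain ⟨p, hp⟩ := hA
    rw [Finset.card_union_of_disjoint hAB, Finset.coe_union]
    refine ⟨?_, ?_⟩
    · have h := hmerge B _ (by omega) hqB hfit'
      convert h using 1
      push_cast
      ring
    · refine (htour.union stepWeight_nonneg htour' (tourBound_nonneg _) (tourBound_nonneg _)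
        hAB hp hqB).mono ?_
      rw [stepWeight_comm q p]
      refine tourBound_add_le hApos hcard ?_
      refine le_stepWeight (n := (A.card : ℤ)) (by omega) fun i => ?_
      exact (hnear p hp i).trans (by linarith)

end Counting

/-- Lemma 4.6: for any plaquette `p` and `m ≥ 1`, the number of knots
`K ∈ 𝒦` of size `m` containing `p` is at most `(10²⁴)^m`. -/
theorem knot_count_bound
    (Λ : Box) (KD : Set (Plaq Λ) → List (Set (Plaq Λ)))
    (hKD : ∀ P : Set (Plaq Λ), IsKnotDecomp P (KD P))
    (p : Plaq Λ) (m : ℕ) (hm : 1 ≤ m) :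
    Nat.card {K : Set (Plaq Λ) // K ∈ Knots KD ∧ Nat.card K = m ∧ p ∈ K}
      ≤ (10 ^ 24) ^ m := by
  let S : Finset (Finset (Plaq Λ)) := Finset.univ.filter fun A =>
    p ∈ A ∧ A.card = m ∧ HasTours stepWeight A (tourBound m)
  have hmem : ∀ K : {K : Set (Plaq Λ) // K ∈ Knots KD ∧ Nat.card K = m ∧ p ∈ K},
      K.1.toFinset ∈ S := by
    rintro ⟨K, ⟨P, hP⟩, hcard, hp⟩
    rw [Nat.card_coe_set_eq, Set.ncard_eq_toFinset_card'] at hcard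
    have hK : Unsplittable (K.toFinset : Set (Plaq Λ)) := by
      rw [Set.coe_toFinset]
      exact (hKD P).maximal K hP
    have hpK : p ∈ K.toFinset := Set.mem_toFinset.mpr hp
    exact Finset.mem_filter.mpr
      ⟨Finset.mem_univ _, hpK, hcard, hcard ▸ hK.hasTours ⟨p, hpK⟩⟩
  have hle : Nat.card {K : Set (Plaq Λ) // K ∈ Knots KD ∧ Nat.card K = m ∧ p ∈ K} ≤ S.card := by
    rw [← Nat.card_eq_finsetCard]
    exact Nat.card_le_card_of_injective (fun K => (⟨K.1.toFinset, hmem K⟩ : S)) fun K K' h =>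
      Subtype.ext (Set.toFinset_inj.mp (congrArg Subtype.val h))
  have hS : S.card * tourBound m ≤ 1 := card_mul_le_of_hasTours stepWeight_nonneg
    sum_stepWeight_le p m _ S fun A hA => (Finset.mem_filter.mp hA).2
  have hm' : (1 : ℝ) ≤ 10 ^ 24 * (m : ℝ) ^ 16 :=
    one_le_mul_of_one_le_of_one_le (by norm_num) (one_le_pow₀ (by exact_mod_cast hm))
  rw [tourBound, ← mul_div_assoc, div_le_one (by positivity)] at hS
  refine hle.trans ?_
  have h := (le_mul_of_one_le_right (Nat.cast_nonneg S.card) hm').trans hS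
  exact_mod_cast h

end LGT
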